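/- arXiv:math/0603356 — 2 statements merged into one kernel-verified Lean document; each statement's English description precedes it below -/
import Mathlib

section
/- Let k be a field of characteristic 2 and let G be a finite group that contains a subgroup isomorphic to the elementary abelian 2-group (ℤ/2ℤ)^n. Then n is strictly less than the Loewy length of the group algebra kG; that is, for every positive integer d such that J(kG)^d = 0 one has n < d. -/
section Helpers

open TensorProduct

section VonNeumannRegular

theorem IsSemisimpleRing.exists_mul_mul_eq {R : Type*} [Ring R] [IsSemisimpleRing R] (x : R) :
    ∃ w, x * w * x = x := by
  obtain ⟨I, hI⟩ := exists_isCompl (Ideal.span {x})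
  obtain ⟨e, he, e', he', h1⟩ := Submodule.mem_sup.1
    (hI.sup_eq_top ▸ Submodule.mem_top : (1 : R) ∈ Ideal.span {x} ⊔ I)
  obtain ⟨w, rfl⟩ := Ideal.mem_span_singleton'.1 he
  refine ⟨w, ?_⟩
  have hx : x * (w * x) + x * e' = x := by rw [← mul_add, h1, mul_one]
  have hxe : x * e' = 0 := by
    have hmem : x * e' ∈ Ideal.span {x} := by
      rw [← eq_sub_iff_add_eq'] at hx
      rw [hx]
      exact sub_mem (Ideal.mem_span_singleton_self x)
        (Ideal.mul_mem_left _ _ he)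
    exact Submodule.disjoint_def.1 hI.disjoint _ hmem (I.mul_mem_left _ he')
  rw [mul_assoc]
  simpa [hxe] using hx

theorem IsArtinianRing.isSemisimpleRing_of_semiprime {R : Type*} [Ring R] [IsArtinianRing R]
    (h : ∀ a : R, (∀ b, a * b * a = 0) → a = 0) : IsSemisimpleRing R := by
  rw [IsArtinianRing.isSemisimpleRing_iff_jacobson]
  obtain ⟨n, hn⟩ : IsNilpotent (Ring.jacobson R) := IsSemiprimaryRing.isNilpotent
  have descend : ∀ m, Ring.jacobson R ^ (m + 2) = 0 → Ring.jacobson R ^ (m + 1) = 0 := by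
    intro m hm
    refine (Submodule.eq_bot_iff _).2 fun a ha ↦ h a fun b ↦ ?_
    have hab : a * b * a ∈ Ring.jacobson R ^ (m + 1) * Ring.jacobson R ^ (m + 1) :=
      Ideal.mul_mem_mul (Ideal.mul_mem_right _ _ ha) ha
    rw [← Ideal.IsTwoSided.pow_add] at hab
    have := Ideal.pow_le_pow_right (by omega : m + 2 ≤ m + 1 + (m + 1)) hab
    rw [hm] at this
    simpa using this
  have key : ∀ m, Ring.jacobson R ^ (m + 1) = 0 → Ring.jacobson R = ⊥ := by
    intro m
    induction m with
    | zero => intro hm; rwa [zero_add, Submodule.pow_one] at hm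
    | succ m ih => exact fun hm ↦ ih (descend m hm)
  refine key n ?_
  have := Ideal.pow_le_pow_right (I := Ring.jacobson R) n.le_succ
  rw [hn] at this
  exact le_bot_iff.1 this

end VonNeumannRegular

theorem AddMonoidAlgebra.eq_zero_of_mul_single_mul_eq_zero {B σ : Type*} [Ring B] [LinearOrder σ]
    (hB : ∀ a : B, (∀ b, a * b * a = 0) → a = 0) (p : AddMonoidAlgebra B (σ →₀ ℕ))
    (hp : ∀ b : B, p * single 0 b * p = 0) : p = 0 := by
  classical
  by_contra hne
  have hsupp : p.coeff.support.Nonempty := by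
    rw [Finsupp.support_nonempty_iff]
    exact fun h ↦ hne (coeff_injective h)
  obtain ⟨m, hm, hmax⟩ := Finset.exists_max_image _ toLex hsupp
  refine Finsupp.mem_support_iff.1 hm (hB _ fun b ↦ ?_)
  have h := congrArg (fun q ↦ q.coeff (m + m)) (hp b)
  have hunique : UniqueAdd p.coeff.support p.coeff.support m m := by
    intro a a' ha ha' he
    have h1 := hmax a ha
    have h2 := hmax a' ha'
    have he' : toLex a + toLex a' = toLex m + toLex m := congrArg toLex he
    exact ⟨toLex.injective (by
      by_contra hlt
      exact (add_lt_add_of_lt_of_le (lt_of_le_of_ne h1 hlt) h2).ne he'),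
      toLex.injective (by
      by_contra hlt
      exact (add_lt_add_of_le_of_lt h1 (lt_of_le_of_ne h2 hlt)).ne he')⟩
  have hunique' : UniqueAdd (p * single 0 b).coeff.support p.coeff.support m m := by
    refine hunique.mono (fun a ha ↦ ?_) subset_rfl
    rw [Finsupp.mem_support_iff, coeff_mul_single_zero] at ha
    exact Finsupp.mem_support_iff.2 (left_ne_zero_of_mul ha)
  rw [coeff_mul_add_of_uniqueAdd hunique', coeff_mul_single_zero] at h
  simpa using h

theorem add_self_eq_zero_of_charTwo (k : Type*) {V : Type*} [Ring k] [CharP k 2] [AddCommGroup V]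
    [Module k V] (v : V) : v + v = 0 := by
  rw [← two_smul k v, CharTwo.two_eq_zero, zero_smul]

section SMul

variable {k P A : Type*} [CommRing k] [CommRing P] [Algebra k P] [Ring A] [Algebra k A]

theorem tmul_one_mul_eq_smul (f : P) (z : P ⊗[k] A) : (f ⊗ₜ[k] (1 : A)) * z = f • z := by
  rw [Algebra.smul_def, Algebra.TensorProduct.algebraMap_apply, Algebra.algebraMap_self_apply]

end SMul

section GenericRegularity

variable {k B σ : Type*} [Field k] [Ring B] [Algebra k B]

variable (k B σ) in
/-- The comparison map from `k[σ] ⊗ B` to polynomials with coefficients in `B`, for `B` not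
necessarily commutative. -/
noncomputable def MvPolynomial.tensorToAddMonoidAlgebra :
    MvPolynomial σ k ⊗[k] B →ₐ[k] AddMonoidAlgebra B (σ →₀ ℕ) :=
  Algebra.TensorProduct.lift (AddMonoidAlgebra.mapAlgHom _ (Algebra.ofId k B))
    AddMonoidAlgebra.singleZeroAlgHom fun p b ↦ by
      induction p using AddMonoidAlgebra.induction_linear with
      | zero => simp
      | add p q hp hq => simpa only [map_add] using hp.add_left hq
      | single m c =>
        simp [Commute, SemiconjBy, AddMonoidAlgebra.single_mul_single, Algebra.ofId_apply,
          Algebra.commutes c b]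

theorem MvPolynomial.tensorToAddMonoidAlgebra_injective :
    Function.Injective (tensorToAddMonoidAlgebra k B σ) := by
  let ψ : AddMonoidAlgebra B (σ →₀ ℕ) →+ MvPolynomial σ k ⊗[k] B :=
    (Finsupp.liftAddHom fun m ↦
      (TensorProduct.mk k (MvPolynomial σ k) B (monomial m 1)).toAddMonoidHom).comp
      AddMonoidAlgebra.coeffAddEquiv.toAddMonoidHom
  refine Function.LeftInverse.injective (g := ψ) fun x ↦ ?_
  induction x with
  | zero => simp
  | add x y hx hy => simp only [map_add, hx, hy]
  | tmul p b =>
    induction p using AddMonoidAlgebra.induction_linear with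
    | zero => simp
    | add p q hp hq => simp only [TensorProduct.add_tmul, map_add, hp, hq]
    | single m c =>
      have h : (monomial m c : MvPolynomial σ k) = c • monomial m 1 := by simp [smul_monomial]
      have hθ : tensorToAddMonoidAlgebra k B σ (AddMonoidAlgebra.single m c ⊗ₜ[k] b) =
          AddMonoidAlgebra.single m (c • b) := by
        simp [tensorToAddMonoidAlgebra, AddMonoidAlgebra.single_mul_single, Algebra.ofId_apply,
          Algebra.smul_def]
      have hψ : ψ (AddMonoidAlgebra.single m (c • b)) = monomial m 1 ⊗ₜ (c • b) := by
        simp [ψ]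
      rw [hθ, hψ, ← TensorProduct.smul_tmul, ← h]
      rfl

theorem MvPolynomial.tensor_eq_zero_of_mul_mul_eq_zero [LinearOrder σ]
    (hB : ∀ a : B, (∀ b, a * b * a = 0) → a = 0) (p : MvPolynomial σ k ⊗[k] B)
    (hp : ∀ b : B, p * (1 ⊗ₜ b) * p = 0) : p = 0 := by
  have he : ∀ b : B, tensorToAddMonoidAlgebra k B σ ((1 : MvPolynomial σ k) ⊗ₜ[k] b) =
      AddMonoidAlgebra.single 0 b := by
    intro b
    simp [tensorToAddMonoidAlgebra]
  refine tensorToAddMonoidAlgebra_injective ?_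
  rw [map_zero]
  refine AddMonoidAlgebra.eq_zero_of_mul_single_mul_eq_zero hB _ fun b ↦ ?_
  rw [← he, ← map_mul, ← map_mul, hp, map_zero]

theorem exists_smul_eq_map_tensor {P : Type*} (K : Type*) [CommRing P] [IsDomain P] [Algebra k P]
    [Field K] [Algebra P K] [IsFractionRing P K] [Algebra k K] [IsScalarTower k P K]
    (z : K ⊗[k] B) : ∃ f : P, f ≠ 0 ∧ ∃ p : P ⊗[k] B,
      Algebra.TensorProduct.map (IsScalarTower.toAlgHom k P K) (AlgHom.id k B) p =
        algebraMap P K f • z := by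
  induction z with
  | zero => exact ⟨1, one_ne_zero, 0, by simp⟩
  | tmul c b =>
    obtain ⟨a, s, hs, rfl⟩ := IsFractionRing.div_surjective (A := P) c
    have hs' : algebraMap P K s ≠ 0 := by
      simpa using nonZeroDivisors.ne_zero hs
    refine ⟨s, nonZeroDivisors.ne_zero hs, a ⊗ₜ b, ?_⟩
    rw [TensorProduct.smul_tmul', smul_eq_mul, mul_div_cancel₀ _ hs']
    simp
  | add x y hx hy =>
    obtain ⟨f, hf, p, hp⟩ := hx
    obtain ⟨g, hg, q, hq⟩ := hy
    refine ⟨f * g, mul_ne_zero hf hg, (g ⊗ₜ 1) * p + (f ⊗ₜ 1) * q, ?_⟩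
    simp only [map_add, map_mul, hp, hq, Algebra.TensorProduct.map_tmul, map_one,
      IsScalarTower.coe_toAlgHom']
    simp only [tmul_one_mul_eq_smul, smul_smul, smul_add]
    rw [mul_comm (algebraMap P K g)]

theorem MvPolynomial.exists_smul_eq_mul_mul [LinearOrder σ] [Module.Finite k B]
    [IsSemisimpleRing B] (x : MvPolynomial σ k ⊗[k] B) :
    ∃ f : MvPolynomial σ k, f ≠ 0 ∧ ∃ w, f • x = x * w * x := by
  have hB : ∀ a : B, (∀ b, a * b * a = 0) → a = 0 := fun a ha ↦ by
    obtain ⟨w, hw⟩ := IsSemisimpleRing.exists_mul_mul_eq a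
    rw [← hw, ha]
  let P := MvPolynomial σ k
  let K := FractionRing P
  let ι := Algebra.TensorProduct.map (IsScalarTower.toAlgHom k P K) (AlgHom.id k B)
  have hι : Function.Injective ι :=
    Module.Flat.rTensor_preserves_injective_linearMap (M := B)
      (IsScalarTower.toAlgHom k P K).toLinearMap (IsFractionRing.injective P K)
  have hιsmul : ∀ (f : P) p, ι (f • p) = algebraMap P K f • ι p := by
    intro f p
    induction p with
    | zero => simp
    | tmul a b =>
      simp only [ι, TensorProduct.smul_tmul', smul_eq_mul, Algebra.TensorProduct.map_tmul, map_mul,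
        IsScalarTower.coe_toAlgHom']
    | add p q hp hq => simp only [smul_add, map_add, hp, hq]
  have hne : ∀ f : P, f ≠ 0 → algebraMap P K f ≠ 0 := fun f hf ↦ by simpa using hf
  have : IsArtinianRing (K ⊗[k] B) := IsArtinianRing.of_finite K _
  have : IsSemisimpleRing (K ⊗[k] B) := by
    refine IsArtinianRing.isSemisimpleRing_of_semiprime fun z hz ↦ ?_
    obtain ⟨f, hf, p, hp⟩ := exists_smul_eq_map_tensor (P := P) K z
    have hp0 : p = 0 := by
      refine MvPolynomial.tensor_eq_zero_of_mul_mul_eq_zero hB p fun b ↦ hι ?_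
      rw [map_mul, map_mul]
      change ι p = _ at hp
      rw [hp, smul_mul_assoc, mul_smul_comm, smul_mul_assoc, hz, smul_zero, smul_zero, map_zero]
    rw [hp0, map_zero] at hp
    exact (smul_eq_zero.1 hp.symm).resolve_left (hne f hf)
  obtain ⟨w, hw⟩ := IsSemisimpleRing.exists_mul_mul_eq (ι x)
  obtain ⟨f, hf, p, hp⟩ := exists_smul_eq_map_tensor (P := P) K w
  change ι p = _ at hp
  refine ⟨f, hf, p, hι ?_⟩
  rw [map_mul, map_mul, hp, hιsmul, mul_smul_comm, smul_mul_assoc, hw]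

end GenericRegularity

section Chain

variable {P R : Type*} [CommRing P] [IsDomain P] [Ring R] [Algebra P R]

theorem exists_smul_prod_mul_eq (N : Submodule P R) {X : R} (hX : X * X = 0)
    (hreg : ∃ f : P, f ≠ 0 ∧ ∃ w, f • X - X * w * X ∈ N) (l : List R)
    (hcomm : ∀ s ∈ l, s * X = X * s)
    (hl : ∀ s ∈ l, ∃ f : P, f ≠ 0 ∧ ∃ u v, f • s - (u * X + X * v) ∈ N) :
    ∃ f : P, f ≠ 0 ∧ ∃ a c, f • (l.prod * X) = X * a * X + c * X ∧
      c * X ∈ N ^ (l.length + 1) ∧ X * (c * X) = 0 := by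
  induction l with
  | nil =>
    obtain ⟨f, hf, w, hw⟩ := hreg
    have hc : (f • (1 : R) - X * w) * X = f • X - X * w * X := by
      rw [sub_mul, smul_mul_assoc, one_mul]
    refine ⟨f, hf, w, f • 1 - X * w, ?_, ?_, ?_⟩
    · rw [hc]; simp
    · rw [hc]; simpa using hw
    · rw [hc, mul_sub, mul_smul_comm, hX, mul_assoc X w, ← mul_assoc X X, hX]
      simp
  | cons s l ih =>
    obtain ⟨f, hf, a, c, hac, hcN, hXc⟩ := ih (fun t ht ↦ hcomm t (List.mem_cons_of_mem _ ht))
      (fun t ht ↦ hl t (List.mem_cons_of_mem _ ht))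
    obtain ⟨g, hg, u, v, hj⟩ := hl s List.mem_cons_self
    have hs := hcomm s List.mem_cons_self
    set j := g • s - (u * X + X * v) with hjdef
    have hgs : g • s = u * X + X * v + j := by rw [hjdef]; abel
    have hgsc : (g • s) * (c * X) = X * (v * c) * X + j * c * X := by
      rw [hgs, add_mul, add_mul, mul_assoc u, hXc, mul_zero, zero_add]
      simp only [mul_assoc]
    refine ⟨g * f, mul_ne_zero hg hf, (g • s) * a + v * c, j * c, ?_, ?_, ?_⟩
    · calc (g * f) • ((s :: l).prod * X) = (g • s) * (f • (l.prod * X)) := by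
            rw [List.prod_cons, smul_mul_smul_comm, mul_assoc]
        _ = X * ((g • s) * a + v * c) * X + j * c * X := by
            rw [hac, mul_add, hgsc, mul_add X, add_mul _ _ X, add_assoc]
            congr 1
            simp only [smul_mul_assoc, mul_smul_comm, ← mul_assoc, hs]
    · rw [List.length_cons, pow_succ', mul_assoc]
      exact Submodule.mul_mem_mul hj hcN
    · have : j * c * X = (g • s) * (c * X) - X * (v * c) * X := by rw [hgsc]; abel
      rw [this, mul_sub, smul_mul_assoc, mul_smul_comm, ← mul_assoc X s, ← hs, mul_assoc s, hXc,
        ← mul_assoc, ← mul_assoc, hX]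
      simp

end Chain

section BaseChange

variable {k P A B : Type*} [CommRing k] [CommRing P] [Algebra k P] [Ring A] [Algebra k A]
  [Ring B] [Algebra k B]

theorem Submodule.baseChange_pow_le (M : Submodule k A) (n : ℕ) :
    M.baseChange P ^ n ≤ (M ^ n).baseChange P := by
  induction n with
  | zero =>
    rw [pow_zero, pow_zero, Submodule.one_eq_span, Submodule.span_le, Set.singleton_subset_iff]
    exact Submodule.tmul_mem_baseChange_of_mem _ (Submodule.one_le.1 le_rfl)
  | succ n ih =>
    rw [pow_succ, pow_succ]
    refine (mul_le_mul_left ih _).trans ?_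
    rw [Submodule.baseChange_eq_span, Submodule.baseChange_eq_span P M, Submodule.span_mul_span,
      Submodule.span_le]
    rintro _ ⟨_, ⟨a, ha, rfl⟩, _, ⟨b, hb, rfl⟩, rfl⟩
    simpa using Submodule.tmul_mem_baseChange_of_mem (1 : P) (Submodule.mul_mem_mul ha hb)

theorem mem_baseChange_ker_of_map_eq_zero (φ : A →ₐ[k] B) (hφ : Function.Surjective φ)
    {x : P ⊗[k] A} (hx : Algebra.TensorProduct.map (AlgHom.id P P) φ x = 0) :
    x ∈ (LinearMap.ker φ.toLinearMap).baseChange P := by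
  have hker := (lTensor_exact P φ.toLinearMap.exact_subtype_ker_map hφ x).1 hx
  obtain ⟨y, rfl⟩ := hker
  exact ⟨y, rfl⟩

theorem surjective_map_id_tensor (φ : A →ₐ[k] B) (hφ : Function.Surjective φ) :
    Function.Surjective (Algebra.TensorProduct.map (AlgHom.id P P) φ) :=
  LinearMap.lTensor_surjective P (g := φ.toLinearMap) hφ

end BaseChange

section Derivation

variable {k P B : Type*} [CommRing k] [CommRing P] [Algebra k P] [Ring B] [Algebra k B]

theorem Derivation.rTensor_mul (D : Derivation k P P) (x y : P ⊗[k] B) :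
    D.toLinearMap.rTensor B (x * y) =
      D.toLinearMap.rTensor B x * y + x * D.toLinearMap.rTensor B y := by
  induction x with
  | zero => simp
  | add x₁ x₂ h₁ h₂ => simp only [add_mul, map_add, h₁, h₂]; abel
  | tmul a b =>
    induction y with
    | zero => simp
    | add y₁ y₂ h₁ h₂ => simp only [mul_add, map_add, h₁, h₂]; abel
    | tmul c d =>
      simp [TensorProduct.add_tmul, mul_comm c (D a), add_comm]

end Derivation

section GenericElement

variable {k A B : Type*} [Field k] [Ring A] [Algebra k A] [Ring B] [Algebra k B] {n : ℕ}

open MvPolynomial in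
/-- The generic linear combination `∑ yᵢ ⊗ xᵢ` of a finite family. -/
noncomputable def genericSum (k : Type*) [Field k] [Algebra k A] (x : Fin n → A) :
    MvPolynomial (Fin n) k ⊗[k] A :=
  ∑ i, X i ⊗ₜ x i

theorem map_genericSum (φ : A →ₐ[k] B) (x : Fin n → A) :
    Algebra.TensorProduct.map (AlgHom.id (MvPolynomial (Fin n) k) _) φ (genericSum k x) =
      genericSum k (φ ∘ x) := by
  simp [genericSum]

theorem genericSum_mul_self [CharP k 2] (x : Fin n → A) (hcomm : ∀ i j, x i * x j = x j * x i)
    (hsq : ∀ i, x i * x i = 0) : genericSum k x * genericSum k x = 0 := by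
  classical
  let f : Fin n → MvPolynomial (Fin n) k ⊗[k] A := fun i ↦ MvPolynomial.X i ⊗ₜ x i
  have hf : ∀ i j, f i * f j = f j * f i := fun i j ↦ by
    simp [f, hcomm i j, mul_comm (MvPolynomial.X i : MvPolynomial (Fin n) k)]
  suffices ∀ s : Finset (Fin n), (∑ i ∈ s, f i) * ∑ i ∈ s, f i = 0 from this Finset.univ
  intro s
  induction s using Finset.induction_on with
  | empty => simp
  | insert i s hi ih =>
    have hc : (∑ j ∈ s, f j) * f i = f i * ∑ j ∈ s, f j := by
      rw [Finset.sum_mul, Finset.mul_sum]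
      exact Finset.sum_congr rfl fun j _ ↦ hf j i
    have hi0 : f i * f i = 0 := by simp [f, hsq i]
    rw [Finset.sum_insert hi, mul_add, add_mul, add_mul, ih, hc, hi0, zero_add, add_zero,
      add_self_eq_zero_of_charTwo k]

theorem one_tmul_mul_genericSum (x : Fin n → A) {a : A} (ha : ∀ j, a * x j = x j * a) :
    (1 ⊗ₜ a) * genericSum k x = genericSum k x * (1 ⊗ₜ a) := by
  simp [genericSum, Finset.mul_sum, Finset.sum_mul, ha]

theorem exists_smul_one_tmul_eq [Module.Finite k B] [IsSemisimpleRing B] (x : Fin n → B) :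
    ∃ f : MvPolynomial (Fin n) k, f ≠ 0 ∧
      (∃ w, f • genericSum k x = genericSum k x * w * genericSum k x) ∧
      ∀ i, ∃ u v, f • (1 ⊗ₜ x i) = u * genericSum k x + genericSum k x * v := by
  classical
  obtain ⟨f, hf, w, hw⟩ := MvPolynomial.exists_smul_eq_mul_mul (genericSum k x)
  refine ⟨f, hf, ⟨w, hw⟩, fun i ↦ ?_⟩
  let D := MvPolynomial.pderiv (R := k) i
  let δ := D.toLinearMap.rTensor B
  have hX : δ (genericSum k x) = 1 ⊗ₜ x i := by
    simp [δ, D, genericSum, MvPolynomial.pderiv_X, Pi.single_apply, TensorProduct.ite_tmul]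
  have h := congrArg δ ((tmul_one_mul_eq_smul f (genericSum k x)).trans hw)
  have hmul := D.rTensor_mul (B := B)
  change ∀ x y, δ (x * y) = δ x * y + x * δ y at hmul
  rw [mul_assoc, hmul, hmul _ (w * _), hX] at h
  refine ⟨1 ⊗ₜ x i * w - δ (f ⊗ₜ 1), δ (w * genericSum k x),
    (tmul_one_mul_eq_smul f _).symm.trans ?_⟩
  rw [sub_mul, mul_assoc, eq_sub_of_add_eq' h]
  abel

end GenericElement

section Trace

variable {k P A : Type*} [CommRing k] [CommRing P] [Algebra k P] [Ring A] [Algebra k A]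

theorem baseChange_mul_comm (τ : A →ₗ[k] k) (hτ : ∀ a b, τ (a * b) = τ (b * a))
    (x y : P ⊗[k] A) : τ.baseChange P (x * y) = τ.baseChange P (y * x) := by
  induction x with
  | zero => simp
  | add x₁ x₂ h₁ h₂ => simp only [add_mul, mul_add, map_add, h₁, h₂]
  | tmul a b =>
    induction y with
    | zero => simp
    | add y₁ y₂ h₁ h₂ => simp only [add_mul, mul_add, map_add, h₁, h₂]
    | tmul c d => simp [mul_comm a c, hτ b d]



theorem List.prod_mul_eq_zero_of_mem {R : Type*} [Ring R] {s : R} (hs : s * s = 0) {l : List R}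
    (hl : s ∈ l) (hcomm : ∀ t ∈ l, t * s = s * t) : l.prod * s = 0 := by
  have hc : ∀ l : List R, (∀ t ∈ l, t * s = s * t) → l.prod * s = s * l.prod := fun l hl ↦
    (Commute.list_prod_left l s hl).eq
  induction l with
  | nil => simp at hl
  | cons t l ih =>
    have hcl : ∀ t ∈ l, t * s = s * t := fun t ht ↦ hcomm t (List.mem_cons_of_mem _ ht)
    rw [List.prod_cons, mul_assoc]
    rcases List.mem_cons.1 hl with rfl | h
    · rw [hc l hcl, ← mul_assoc, hs, zero_mul]
    · rw [ih h hcl, mul_zero]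

theorem trace_eq_zero_of_smul_sub_mem {B : Type*} [IsDomain P] [Ring B] [Algebra k B]
    (φ : A →ₐ[k] B) (hφ : Function.Surjective φ) {d n : ℕ}
    (hd : LinearMap.ker φ.toLinearMap ^ d = ⊥) (hdn : d ≤ n + 1) (τ : A →ₗ[k] k)
    (hτ : ∀ a b, τ (a * b) = τ (b * a)) {X : P ⊗[k] A} (hXX : X * X = 0) {f : P} (hf : f ≠ 0)
    (hreg : ∃ w, f • Algebra.TensorProduct.map (AlgHom.id P P) φ X =
      Algebra.TensorProduct.map (AlgHom.id P P) φ X * w *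
        Algebra.TensorProduct.map (AlgHom.id P P) φ X)
    (x : Fin n → A) (hcomm : ∀ i, (1 ⊗ₜ x i) * X = X * (1 ⊗ₜ x i))
    (hx : ∀ i, ∃ u v, f • (1 ⊗ₜ φ (x i)) = u * Algebra.TensorProduct.map (AlgHom.id P P) φ X +
        Algebra.TensorProduct.map (AlgHom.id P P) φ X * v) {y : P} (hy : y ≠ 0) {b : A}
    (hb : (1 ⊗ₜ (List.ofFn x).prod) * X = y ⊗ₜ b) :
    algebraMap k P (τ b) = 0 := by
  set M := LinearMap.ker φ.toLinearMap with hM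
  set Φ := Algebra.TensorProduct.map (AlgHom.id P P) φ with hΦ
  have hΦsurj : Function.Surjective Φ := surjective_map_id_tensor φ hφ
  obtain ⟨w, hw⟩ := hreg
  obtain ⟨w, rfl⟩ := hΦsurj w
  set l : List (P ⊗[k] A) := List.ofFn fun i : Fin n ↦ (1 : P) ⊗ₜ[k] x i with hl
  obtain ⟨g, hg, a, c, hac, hcN, -⟩ := exists_smul_prod_mul_eq (M.baseChange P) hXX
    ⟨f, hf, w, mem_baseChange_ker_of_map_eq_zero φ hφ (by
      rw [map_sub, map_smul, map_mul, map_mul, ← hΦ, ← hw, sub_self])⟩ l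
    (by
      intro s hs
      obtain ⟨i, rfl⟩ := (List.mem_ofFn' _ _).1 hs
      exact hcomm i)
    (by
      intro s hs
      obtain ⟨i, rfl⟩ := (List.mem_ofFn' _ _).1 hs
      obtain ⟨u, v, h⟩ := hx i
      obtain ⟨u, rfl⟩ := hΦsurj u
      obtain ⟨v, rfl⟩ := hΦsurj v
      refine ⟨f, hf, u, v, mem_baseChange_ker_of_map_eq_zero φ hφ ?_⟩
      rw [map_sub, map_smul, map_add, map_mul, map_mul, ← hΦ, ← h]
      simp [hΦ])
  have hzero : c * X = 0 := by
    have hM0 : M ^ (n + 1) = ⊥ := by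
      rw [← Nat.sub_add_cancel hdn, pow_add, hd, Submodule.mul_bot]
    have := Submodule.baseChange_pow_le M _ hcN
    rw [hl, List.length_ofFn, hM0] at this
    simpa using this
  have hprod : l.prod = 1 ⊗ₜ (List.ofFn x).prod := by
    have := map_list_prod (Algebra.TensorProduct.includeRight : A →ₐ[k] P ⊗[k] A) (List.ofFn x)
    rw [List.map_ofFn] at this
    exact this.symm
  have htr : τ.baseChange P (g • (l.prod * X)) = 0 := by
    rw [hac, hzero, add_zero, mul_assoc, baseChange_mul_comm τ hτ, mul_assoc, hXX, mul_zero,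
      map_zero]
  rw [map_smul, hprod, hb, LinearMap.baseChange_tmul] at htr
  have htr' := congrArg (TensorProduct.rid k P) htr
  simpa [TensorProduct.smul_tmul', hg, hy, Algebra.smul_def] using htr'

end Trace

theorem trace_prod_eq_zero {k A B : Type*} [Field k] [CharP k 2] [Ring A] [Algebra k A] [Ring B]
    [Algebra k B] [Module.Finite k B] [IsSemisimpleRing B] (φ : A →ₐ[k] B)
    (hφ : Function.Surjective φ) {d n : ℕ} (hd : LinearMap.ker φ.toLinearMap ^ d = ⊥)
    (hdn : d ≤ n + 1) (τ : A →ₗ[k] k) (hτ : ∀ a b, τ (a * b) = τ (b * a)) (x : Fin (n + 1) → A)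
    (hcomm : ∀ i j, x i * x j = x j * x i) (hsq : ∀ i, x i * x i = 0) :
    τ ((List.ofFn fun i : Fin n ↦ x i.succ).prod * x 0) = 0 := by
  obtain ⟨f, hf, hw, huv⟩ := exists_smul_one_tmul_eq (k := k) (φ ∘ x)
  rw [← map_genericSum] at hw huv
  have hz : ∀ i : Fin n, (List.ofFn fun i : Fin n ↦ x i.succ).prod * x i.succ = 0 := fun i ↦
    List.prod_mul_eq_zero_of_mem (hsq _) ((List.mem_ofFn' _ _).2 ⟨i, rfl⟩) fun t ht ↦ by
      obtain ⟨j, rfl⟩ := (List.mem_ofFn' _ _).1 ht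
      exact hcomm _ _
  have hb : (1 ⊗ₜ (List.ofFn fun i : Fin n ↦ x i.succ).prod) * genericSum k x =
      MvPolynomial.X 0 ⊗ₜ ((List.ofFn fun i : Fin n ↦ x i.succ).prod * x 0) := by
    rw [genericSum, Fin.sum_univ_succ]
    simp [mul_add, Finset.mul_sum, hz]
  have h := trace_eq_zero_of_smul_sub_mem φ hφ hd hdn τ hτ (genericSum_mul_self x hcomm hsq) hf hw
    (fun i : Fin n ↦ x i.succ) (fun i ↦ one_tmul_mul_genericSum x (hcomm _))
    (fun i ↦ huv i.succ) (MvPolynomial.X_ne_zero 0) hb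
  exact (FaithfulSMul.algebraMap_eq_zero_iff k (MvPolynomial (Fin (n + 1)) k)).1 h

section GroupAlgebra

variable {k G : Type*} [Field k] [Group G]

theorem MonoidAlgebra.coeff_one_mul_comm (a b : MonoidAlgebra k G) :
    (a * b).coeff 1 = (b * a).coeff 1 := by
  classical
  induction a using MonoidAlgebra.induction_linear with
  | zero => simp
  | add a₁ a₂ h₁ h₂ => simp [add_mul, mul_add, h₁, h₂]
  | single g r =>
    induction b using MonoidAlgebra.induction_linear with
    | zero => simp
    | add b₁ b₂ h₁ h₂ => simp [add_mul, mul_add, h₁, h₂]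
    | single h s =>
      rw [MonoidAlgebra.single_mul_single, MonoidAlgebra.single_mul_single, mul_comm r s]
      simp only [MonoidAlgebra.coeff_single, Finsupp.single_apply]
      exact if_congr mul_eq_one_comm rfl rfl

/-- The coefficient at the identity, as a linear form on the group algebra. -/
def MonoidAlgebra.coeffOne (k G : Type*) [Field k] [Group G] : MonoidAlgebra k G →ₗ[k] k where
  toFun x := x.coeff 1
  map_add' x y := by simp
  map_smul' c x := by simp

theorem MonoidAlgebra.coeff_one_prod_add_one {n : ℕ} :
    (∏ i : Fin n, (MonoidAlgebra.of k (Multiplicative (Fin n → ZMod 2))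
      (Multiplicative.ofAdd (Pi.single i 1)) + 1)).coeff 1 = 1 := by
  classical
  rw [Finset.prod_add_one]
  simp only [← map_prod]
  have hsum : ∀ (s : Finset (Finset (Fin n))) 
      (F : Finset (Fin n) → MonoidAlgebra k (Multiplicative (Fin n → ZMod 2))),
      (∑ t ∈ s, F t).coeff 1 = ∑ t ∈ s, (F t).coeff 1 := fun s F ↦
    map_sum (MonoidAlgebra.coeffOne k _) F s
  rw [hsum, Finset.sum_eq_single ∅]
  · simp
  · intro t _ ht
    obtain ⟨i, hi⟩ := Finset.nonempty_iff_ne_empty.2 ht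
    rw [MonoidAlgebra.of_apply, MonoidAlgebra.coeff_single, Finsupp.single_apply, if_neg]
    intro h
    have h' := congrFun (congrArg Multiplicative.toAdd h) i
    rw [toAdd_prod] at h'
    simp [Finset.sum_apply, Pi.single_apply, hi] at h'
  · simp

theorem ker_mk_jacobson_pow_eq_bot (k : Type*) {A : Type*} [Field k] [Ring A] [Algebra k A]
    {d : ℕ}
    (h : ∀ l : List A, l.length = d → (∀ x ∈ l, x ∈ (⊥ : Ideal A).jacobson) → l.prod = 0) :
    LinearMap.ker (Ideal.Quotient.mkₐ k (Ring.jacobson A)).toLinearMap ^ d = ⊥ := by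
  rw [Submodule.pow_eq_span_pow_set, Submodule.span_eq_bot]
  intro a ha
  obtain ⟨f, rfl⟩ := Set.mem_pow.1 ha
  refine h _ (List.length_ofFn ..) fun x hx ↦ ?_
  obtain ⟨i, rfl⟩ := (List.mem_ofFn' _ _).1 hx
  have := (f i).2
  rw [Ideal.jacobson_bot]
  exact Ideal.Quotient.eq_zero_iff_mem.1 this

end GroupAlgebra

end Helpers

/-- **Benson's conjecture at the prime 2** (Rouquier).
Let `k` be a field of characteristic `2` and `G` a finite group containing a subgroup
isomorphic to the elementary abelian `2`-group `(ℤ/2ℤ)^n`.  Then `n` is strictly smaller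
than the Loewy length of the group algebra `kG`: for every positive integer `d` with
`J(kG)^d = 0` (i.e. every product of `d` elements of the Jacobson radical vanishes),
one has `n < d`. -/
theorem loewy_length_gt_of_elementary_abelian_two_subgroup
    (k : Type) [Field k] [CharP k 2] (G : Type) [Group G] [Finite G] (n : ℕ)
    (H : Subgroup G) (hH : Nonempty (H ≃* Multiplicative (Fin n → ZMod 2)))
    (d : ℕ) (hd : 0 < d)
    (hJd : ∀ l : List (MonoidAlgebra k G), l.length = d →
      (∀ x ∈ l, x ∈ (⊥ : Ideal (MonoidAlgebra k G)).jacobson) → l.prod = 0) :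
    n < d := by
  obtain ⟨e⟩ := hH
  obtain _ | m := n
  · exact hd
  by_contra! hdm
  let A := MonoidAlgebra k G
  let ι : Multiplicative (Fin (m + 1) → ZMod 2) →* G := H.subtype.comp e.symm.toMonoidHom
  have hι : Function.Injective ι := H.subtype_injective.comp e.symm.injective
  let Ψ := MonoidAlgebra.mapDomainAlgHom k k ι
  let y : Fin (m + 1) → MonoidAlgebra k (Multiplicative (Fin (m + 1) → ZMod 2)) := fun i ↦
    MonoidAlgebra.of k _ (Multiplicative.ofAdd (Pi.single i 1)) + 1
  have hy : ∀ i, y i * y i = 0 := fun i ↦ by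
    have : (MonoidAlgebra.of k (Multiplicative (Fin (m + 1) → ZMod 2))
      (Multiplicative.ofAdd (Pi.single i 1))) *
        MonoidAlgebra.of k _ (Multiplicative.ofAdd (Pi.single i 1)) = 1 := by
      rw [← map_mul, ← ofAdd_add, ← Pi.single_add, CharTwo.add_self_eq_zero, Pi.single_zero,
        ofAdd_zero, map_one]
    simp only [y]
    rw [mul_add, add_mul, add_mul, this, mul_one, one_mul, mul_one, add_comm 1,
      add_self_eq_zero_of_charTwo k]
  have : IsArtinianRing A := IsArtinianRing.of_finite k A
  have htr := trace_prod_eq_zero (Ideal.Quotient.mkₐ k (Ring.jacobson A))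
    (Ideal.Quotient.mkₐ_surjective k _) (ker_mk_jacobson_pow_eq_bot k hJd) hdm
    (MonoidAlgebra.coeffOne k G) MonoidAlgebra.coeff_one_mul_comm (fun i ↦ Ψ (y i))
    (fun i j ↦ by rw [← map_mul, mul_comm, map_mul]) (fun i ↦ by rw [← map_mul, hy, map_zero])
  have hprod : (List.ofFn fun i : Fin m ↦ Ψ (y i.succ)).prod * Ψ (y 0) = Ψ (∏ i, y i) := by
    rw [Fin.prod_univ_succ, mul_comm, map_mul, ← List.prod_ofFn, map_list_prod, List.map_ofFn]
    rfl
  have hcoeff : ∀ z, (Ψ z).coeff 1 = z.coeff 1 := fun z ↦ by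
    have := Finsupp.mapDomain_apply hι z.coeff 1
    rwa [map_one] at this
  rw [hprod] at htr
  have := (hcoeff _).symm.trans htr
  rw [MonoidAlgebra.coeff_one_prod_add_one] at this
  exact one_ne_zero this
end

section
/- Let k be a field and n a positive integer, and let Λ = Λ(k^n) be the exterior algebra of an n-dimensional k-vector space. Then the representation dimension of Λ equals n + 1; that is, the infimum over all finitely generated Λ-modules M of the global dimension of the endomorphism algebra End_Λ(Λ ⊕ Λ* ⊕ M) is equal to n + 1. -/
/-!
Representation dimension of exterior algebras (Rouquier):
`repdim Λ(kⁿ) = n + 1`.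
-/

section ProjDim

/-- `pdLE B d M` says that the left `B`-module `M` has projective dimension at most `d`,
i.e. there is a projective resolution `0 → P_d → ⋯ → P_0 → M → 0`. -/
def pdLE (B : Type) [Ring B] : ℕ → (M : Type) → [AddCommGroup M] → [Module B M] → Prop
  | 0, M, _, _ => Module.Projective B M
  | d + 1, M, _, _ => ∃ (P : Type) (_ : AddCommGroup P) (_ : Module B P)
      (f : P →ₗ[B] M), Function.Surjective f ∧ Module.Projective B P ∧
        pdLE B d (LinearMap.ker f)

/-- `gldimLE B d` says that the global dimension of `B` is at most `d` : every
`B`-module has projective dimension at most `d`. -/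
def gldimLE (B : Type) [Ring B] (d : ℕ) : Prop :=
  ∀ (M : Type) (_ : AddCommGroup M) (_ : Module B M), pdLE B d M

/-- The global dimension of a ring `B`, as an element of `ℕ∞`:
the supremum of the projective dimensions of all `B`-modules. -/
noncomputable def gldim (B : Type) [Ring B] : ℕ∞ :=
  sInf ((↑) '' {d : ℕ | gldimLE B d})

end ProjDim

section RepDim

variable (k : Type) [Field k] (A : Type) [Ring A] [Algebra k A]

/-- The `k`-linear dual `A* = Hom_k(A, k)` of a `k`-algebra `A`, as a left `A`-module via
`(a • f) x = f (x * a)`. -/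
instance dualSMul : SMul A (A →ₗ[k] k) :=
  ⟨fun a f => f ∘ₗ LinearMap.mulRight k a⟩

theorem dualSMul_apply (a : A) (f : A →ₗ[k] k) (x : A) : (a • f) x = f (x * a) := rfl

instance dualModule : Module A (A →ₗ[k] k) where
  one_smul f := by ext x; simp [dualSMul_apply]
  mul_smul a b f := by ext x; simp [dualSMul_apply, mul_assoc]
  smul_zero a := by ext x; simp [dualSMul_apply]
  smul_add a f g := by ext x; simp [dualSMul_apply]
  add_smul a b f := by ext x; simp [dualSMul_apply, mul_add]
  zero_smul f := by ext x; simp [dualSMul_apply]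

/-- The representation dimension of a finite dimensional `k`-algebra `A` (Auslander):
the infimum over all finitely generated `A`-modules `M` of the global dimension of
`End_A(A ⊕ A* ⊕ M)`. -/
noncomputable def repdim : ℕ∞ :=
  sInf {x : ℕ∞ | ∃ (M : Type) (_ : AddCommGroup M) (_ : Module A M),
    Module.Finite A M ∧ gldim (Module.End A (A × (A →ₗ[k] k) × M)) = x}

end RepDim

section HomologicalDimension

open CategoryTheory

/-- `PdLT B M n` says that the `B`-module `M` has projective dimension less than `n`. -/
abbrev PdLT (B : Type) [Ring B] (M : Type) [AddCommGroup M] [Module B M] (n : ℕ) : Prop :=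
  HasProjectiveDimensionLT (ModuleCat.of B M) n

variable {B : Type} [Ring B] {M N : Type} [AddCommGroup M] [Module B M] [AddCommGroup N]
  [Module B N]

theorem PdLT.congr (e : M ≃ₗ[B] N) {n : ℕ} (h : PdLT B M n) : PdLT B N n :=
  hasProjectiveDimensionLT_of_iso e.toModuleIso n

theorem PdLT.mono {n m : ℕ} (h : PdLT B M n) (hnm : n ≤ m) : PdLT B M m :=
  hasProjectiveDimensionLT_of_ge _ n m hnm

theorem pdLT_one_iff : PdLT B M 1 ↔ Module.Projective B M := by
  rw [PdLT, ← projective_iff_hasProjectiveDimensionLT_one, IsProjective.iff_projective]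

theorem pdLT_zero_of_subsingleton [Subsingleton M] : PdLT B M 0 :=
  (ModuleCat.isZero_of_subsingleton (ModuleCat.of B M)).hasProjectiveDimensionLT_zero

theorem PdLT.of_ker {f : M →ₗ[B] N} (hf : Function.Surjective f) {n : ℕ}
    (hK : PdLT B (LinearMap.ker f) n) (hM : PdLT B M (n + 1)) : PdLT B N (n + 1) :=
  (LinearMap.shortExact_shortComplexKer hf).hasProjectiveDimensionLT_X₃ n hK hM

theorem PdLT.ker {f : M →ₗ[B] N} (hf : Function.Surjective f) {n : ℕ}
    (hM : PdLT B M n) (hN : PdLT B N (n + 1)) : PdLT B (LinearMap.ker f) n :=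
  (LinearMap.shortExact_shortComplexKer hf).hasProjectiveDimensionLT_X₁ n hM hN

theorem PdLT.middle {f : M →ₗ[B] N} (hf : Function.Surjective f) {n : ℕ}
    (hK : PdLT B (LinearMap.ker f) n) (hN : PdLT B N n) : PdLT B M n :=
  (LinearMap.shortExact_shortComplexKer hf).hasProjectiveDimensionLT_X₂ n hK hN

theorem pdLE_iff_pdLT (d : ℕ) (M : Type) [AddCommGroup M] [Module B M] :
    pdLE B d M ↔ PdLT B M (d + 1) := by
  induction d generalizing M with
  | zero => exact pdLT_one_iff.symm
  | succ d ih =>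
    constructor
    · rintro ⟨P, _, _, f, hf, hP, hK⟩
      exact PdLT.of_ker hf ((ih _).1 hK) ((pdLT_one_iff.2 hP).mono (by lia))
    · intro h
      refine ⟨M →₀ B, inferInstance, inferInstance, Finsupp.linearCombination B id,
        Finsupp.linearCombination_id_surjective B M, inferInstance, (ih _).2 ?_⟩
      exact PdLT.ker (Finsupp.linearCombination_id_surjective B M)
        ((pdLT_one_iff.2 inferInstance).mono (by lia)) h

theorem hasInjectiveDimensionLT_of_ext_quotient (d : ℕ) (Y : ModuleCat.{0} B)
    (h : ∀ I : Ideal B, Subsingleton (Abelian.Ext (ModuleCat.of B (B ⧸ I)) Y (d + 1))) :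
    HasInjectiveDimensionLT Y (d + 1) := by
  induction d generalizing Y with
  | zero =>
    rw [← injective_iff_hasInjectiveDimensionLT_one, ← Module.injective_iff_injective_object,
      ← Module.Baer.iff_injective]
    intro I g
    have hS := ModuleCat.shortComplex_shortExact
      (ModuleCat.shortComplexOfCompEqZero I.subtype I.mkQ (by ext; simp))
      (LinearMap.exact_subtype_mkQ I) I.injective_subtype I.mkQ_surjective
    obtain ⟨x, hx⟩ := Abelian.Ext.contravariant_sequence_exact₁ hS Y
      (Abelian.Ext.mk₀ (ModuleCat.ofHom g)) (n₁ := 1) rfl ((h I).elim _ _)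
    obtain ⟨φ, rfl⟩ := (Abelian.Ext.mk₀_bijective _ _).2 x
    rw [Abelian.Ext.mk₀_comp_mk₀] at hx
    have h2 := (Abelian.Ext.mk₀_bijective _ _).1 hx
    refine ⟨φ.hom, fun x hx => ?_⟩
    exact congrArg (fun t => t.hom ⟨x, hx⟩) h2
  | succ d ih =>
    obtain ⟨J, _, f, _⟩ := EnoughInjectives.presentation Y
    have hS : (ShortComplex.mk f _ (Limits.cokernel.condition f)).ShortExact :=
      { exact := ShortComplex.exact_cokernel f }
    refine hS.hasInjectiveDimensionLT_X₁ _ ?_ inferInstance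
    refine ih _ fun I => ⟨fun a b => ?_⟩
    suffices H : ∀ a : Abelian.Ext (ModuleCat.of B (B ⧸ I)) (Limits.cokernel f) (d + 1), a = 0 by
      rw [H a, H b]
    intro a
    obtain ⟨x, rfl⟩ := Abelian.Ext.covariant_sequence_exact₃ _ hS a rfl ((h I).elim _ _)
    rw [Abelian.Ext.eq_zero_of_injective x, Abelian.Ext.zero_comp]

/-- Auslander's lemma: the global dimension is controlled by the cyclic modules. -/
theorem gldimLE_of_cyclic (d : ℕ) (h : ∀ I : Ideal B, PdLT B (B ⧸ I) (d + 1)) :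
    gldimLE B d := by
  intro M _ _
  rw [pdLE_iff_pdLT, PdLT, hasProjectiveDimensionLT_iff]
  intro i hi Y e
  have hY : HasInjectiveDimensionLT Y (d + 1) :=
    hasInjectiveDimensionLT_of_ext_quotient d Y fun I =>
      have := h I
      HasProjectiveDimensionLT.subsingleton _ (d + 1) (d + 1) le_rfl Y
  exact e.eq_zero_of_hasInjectiveDimensionLT (d + 1) hi

end HomologicalDimension

section HomInto

variable {A : Type} [Ring A] (X : Type) [AddCommGroup X] [Module A X]
  {W Y Z : Type} [AddCommGroup W] [Module A W] [AddCommGroup Y] [Module A Y]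
  [AddCommGroup Z] [Module A Z]

/-- Precomposition with `u`, as a map of modules over `End_A(X)`. -/
def precompEnd (u : W →ₗ[A] Y) : (Y →ₗ[A] X) →ₗ[Module.End A X] (W →ₗ[A] X) where
  toFun g := g ∘ₗ u
  map_add' _ _ := rfl
  map_smul' _ _ := rfl

@[simp] theorem precompEnd_apply (u : W →ₗ[A] Y) (g : Y →ₗ[A] X) :
    precompEnd X u g = g ∘ₗ u := rfl

/-- `Hom_A(W, X)` is a projective module over `End_A(X)`. -/
abbrev HomProj (W : Type) [AddCommGroup W] [Module A W] : Prop :=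
  Module.Projective (Module.End A X) (W →ₗ[A] X)

/-- `Hom_A(W, X)` has projective dimension less than `n` over `End_A(X)`. -/
abbrev HomPdLT (W : Type) [AddCommGroup W] [Module A W] (n : ℕ) : Prop :=
  PdLT (Module.End A X) (W →ₗ[A] X) n

theorem homProj_self : HomProj X (A := A) X := by
  let e : Module.End A X ≃ₗ[Module.End A X] (X →ₗ[A] X) :=
    { toFun := fun f => f
      invFun := fun f => f
      map_add' := fun _ _ => rfl
      map_smul' := fun _ _ => rfl }
  exact Module.Projective.of_equiv e

variable {X}

theorem HomProj.retract (h : HomProj (A := A) X Y) (i : W →ₗ[A] Y) (r : Y →ₗ[A] W)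
    (hr : r ∘ₗ i = LinearMap.id) : HomProj (A := A) X W :=
  Module.Projective.of_split (precompEnd X r) (precompEnd X i) (by
    ext f x
    exact congrArg f (LinearMap.congr_fun hr x))

theorem HomProj.equiv (h : HomProj (A := A) X Y) (e : W ≃ₗ[A] Y) : HomProj (A := A) X W :=
  h.retract e.toLinearMap e.symm.toLinearMap (by ext; simp)

theorem HomProj.prod (h : HomProj (A := A) X Y) (h' : HomProj (A := A) X Z) :
    HomProj (A := A) X (Y × Z) := by
  let e : ((Y →ₗ[A] X) × (Z →ₗ[A] X)) ≃ₗ[Module.End A X] (Y × Z →ₗ[A] X) :=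
    { toFun := fun f => f.1.coprod f.2
      invFun := fun f => (f ∘ₗ LinearMap.inl A Y Z, f ∘ₗ LinearMap.inr A Y Z)
      map_add' := fun f g => by ext <;> simp
      map_smul' := fun b f => by ext <;> simp
      left_inv := fun f => by ext <;> simp
      right_inv := fun f => by ext <;> simp }
  exact Module.Projective.of_equiv e

theorem HomProj.pi {m : ℕ} (h : HomProj (A := A) X Y) : HomProj (A := A) X (Fin m → Y) := by
  induction m with
  | zero =>
    have : Subsingleton ((Fin 0 → Y) →ₗ[A] X) :=
      ⟨fun f g => LinearMap.ext fun x => by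
        rw [Subsingleton.elim x 0, map_zero, map_zero]⟩
    exact (pdLT_one_iff.1 (pdLT_zero_of_subsingleton.mono zero_le_one))
  | succ m ih =>
    exact (h.prod ih).equiv (Fin.consLinearEquiv A fun _ : Fin (m + 1) => Y).symm

theorem precompEnd_ker_equiv (u : W →ₗ[A] Y) :
    Nonempty (((Y ⧸ LinearMap.range u) →ₗ[A] X) ≃ₗ[Module.End A X]
      LinearMap.ker (precompEnd X u)) := by
  refine ⟨LinearEquiv.ofBijective
    ((precompEnd X (LinearMap.range u).mkQ).codRestrict _ fun g => ?_) ⟨?_, ?_⟩⟩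
  · ext x
    simp [(Submodule.Quotient.mk_eq_zero _).2 (LinearMap.mem_range_self u x)]
  · intro f g hfg
    have := congrArg Subtype.val hfg
    exact (LinearMap.cancel_right (Submodule.mkQ_surjective _)).1 this
  · rintro ⟨g, hg⟩
    refine ⟨(LinearMap.range u).liftQ g ?_, Subtype.ext (Submodule.liftQ_mkQ _ _ _)⟩
    rintro _ ⟨x, rfl⟩
    exact LinearMap.congr_fun (LinearMap.mem_ker.1 hg) x

/-- A left approximation computes projective dimensions: upper bound. -/
theorem HomPdLT.of_approx (u : W →ₗ[A] Y) (hu : Function.Surjective (precompEnd X u))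
    (hY : HomProj (A := A) X Y) {n : ℕ}
    (h : HomPdLT (A := A) X (Y ⧸ LinearMap.range u) n) : HomPdLT (A := A) X W (n + 1) :=
  PdLT.of_ker hu (h.congr (precompEnd_ker_equiv u).some) ((pdLT_one_iff.2 hY).mono (by lia))

/-- A left approximation computes projective dimensions: lower bound. -/
theorem HomPdLT.coker (u : W →ₗ[A] Y) (hu : Function.Surjective (precompEnd X u))
    (hY : HomProj (A := A) X Y) {n : ℕ} (h : HomPdLT (A := A) X W (n + 2)) :
    HomPdLT (A := A) X (Y ⧸ LinearMap.range u) (n + 1) :=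
  (PdLT.ker hu ((pdLT_one_iff.2 hY).mono (by lia)) h).congr (precompEnd_ker_equiv u).some.symm

/-- If `Hom_A(W, X)` is projective, a monomorphic left approximation with values in a power of
`X` splits, provided `X` cogenerates. -/
theorem HomProj.exists_retraction (hW : HomProj (A := A) X W) {m : ℕ}
    (u : W →ₗ[A] (Fin m → X)) (hu : Function.Surjective (precompEnd X u))
    (hinj : Function.Injective u)
    (hcog : ∀ q : (Fin m → X) ⧸ LinearMap.range u, q ≠ 0 →
      ∃ g : ((Fin m → X) ⧸ LinearMap.range u) →ₗ[A] X, g q ≠ 0) :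
    ∃ r : (Fin m → X) →ₗ[A] W, r ∘ₗ u = LinearMap.id := by
  obtain ⟨s, hs⟩ := Module.projective_lifting_property (precompEnd X u) LinearMap.id hu
  have hs' (f : W →ₗ[A] X) : s f ∘ₗ u = f := LinearMap.congr_fun hs f
  let e : (Fin m → X) →ₗ[A] (Fin m → X) :=
    LinearMap.pi fun i => s (LinearMap.proj i ∘ₗ u)
  have he (g : (Fin m → X) →ₗ[A] X) : s (g ∘ₗ u) = g ∘ₗ e := by
    have hg : g = ∑ i, (g ∘ₗ LinearMap.single A (fun _ : Fin m => X) i : Module.End A X) •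
        (LinearMap.proj i : (Fin m → X) →ₗ[A] X) := by
      refine LinearMap.pi_ext fun i x => ?_
      simp only [LinearMap.sum_apply, LinearMap.smul_apply, Module.End.smul_def,
        LinearMap.proj_apply, LinearMap.comp_apply, LinearMap.single_apply]
      rw [Finset.sum_eq_single i]
      · simp
      · intro j _ hj
        simp [Pi.single_eq_of_ne hj]
      · simp
    have hgu : g ∘ₗ u = ∑ i, (g ∘ₗ LinearMap.single A (fun _ : Fin m => X) i : Module.End A X) •
        (LinearMap.proj i ∘ₗ u : W →ₗ[A] X) := by
      conv_lhs => rw [hg]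
      ext x
      simp [LinearMap.sum_apply]
    rw [hgu, map_sum]
    conv_rhs => rw [hg]
    ext x
    simp [e]
  have heu : e ∘ₗ u = u := by
    ext x i
    exact LinearMap.congr_fun (hs' (LinearMap.proj i ∘ₗ u)) x
  have hrange : ∀ y, e y ∈ LinearMap.range u := by
    intro y
    by_contra hy
    obtain ⟨g, hg⟩ := hcog ((LinearMap.range u).mkQ (e y)) (by simpa using hy)
    refine hg ?_
    have h1 := LinearMap.congr_fun (he (g ∘ₗ (LinearMap.range u).mkQ)) y
    have h2 : (g ∘ₗ (LinearMap.range u).mkQ) ∘ₗ u = 0 := by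
      ext x
      simp [(Submodule.Quotient.mk_eq_zero _).2 (LinearMap.mem_range_self u x)]
    rw [h2, map_zero] at h1
    exact h1.symm
  let eq := LinearEquiv.ofInjective u hinj
  refine ⟨eq.symm.toLinearMap ∘ₗ e.codRestrict _ hrange, ?_⟩
  ext x
  apply hinj
  have : eq (eq.symm (e.codRestrict _ hrange (u x))) = e.codRestrict _ hrange (u x) := by simp
  have h3 := congrArg Subtype.val this
  simpa [eq, LinearEquiv.ofInjective_apply] using h3.trans (LinearMap.congr_fun heu x)

end HomInto

section FiniteDimensional

variable (k : Type) [Field k] {A : Type} [Ring A] [Algebra k A]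
  {X W Z : Type} [AddCommGroup X] [Module A X] [Module k X] [IsScalarTower k A X]
  [AddCommGroup W] [Module A W] [Module k W] [IsScalarTower k A W]
  [AddCommGroup Z] [Module A Z] [Module k Z] [IsScalarTower k A Z]

/-- Functionals on `W` correspond to `A`-linear maps from `W` to the dual `A*`. -/
def toDual {k : Type} [Field k] {A : Type} [Ring A] [Algebra k A] {W : Type} [AddCommGroup W]
    [Module A W] [Module k W] [IsScalarTower k A W] (φ : W →ₗ[k] k) :
    W →ₗ[A] (A →ₗ[k] k) where
  toFun w := φ ∘ₗ (LinearMap.toSpanSingleton A W w).restrictScalars k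
  map_add' w w' := by ext; simp
  map_smul' a w := by ext x; simp [dualSMul_apply, mul_smul]

@[simp] theorem toDual_apply (φ : W →ₗ[k] k) (w : W) (a : A) : toDual φ w a = φ (a • w) := rfl

theorem exists_toDual_ne_zero {w : W} (hw : w ≠ 0) : ∃ g : W →ₗ[A] (A →ₗ[k] k), g w ≠ 0 := by
  obtain ⟨φ, hφ⟩ : ∃ φ : W →ₗ[k] k, φ w ≠ 0 := by
    by_contra! h
    exact hw ((Module.forall_dual_apply_eq_zero_iff k w).1 h)
  refine ⟨toDual φ, fun h => hφ ?_⟩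
  simpa using LinearMap.congr_fun h 1

theorem finite_linearMap [FiniteDimensional k W] [FiniteDimensional k Z] :
    Module.Finite k (W →ₗ[A] Z) :=
  Module.Finite.of_injective (LinearMap.restrictScalarsₗ k A W Z k)
    (LinearMap.restrictScalars_injective k)

theorem exists_left_approximation [FiniteDimensional k W] [FiniteDimensional k Z] :
    ∃ (m : ℕ) (u : W →ₗ[A] (Fin m → Z)), ∀ g : W →ₗ[A] Z,
      ∃ g' : (Fin m → Z) →ₗ[A] Z, g' ∘ₗ u = g := by
  have := finite_linearMap k (A := A) (W := W) (Z := Z)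
  obtain ⟨m, f, hf⟩ := Module.Finite.exists_fin (R := k) (M := W →ₗ[A] Z)
  refine ⟨m, LinearMap.pi f, fun g => ?_⟩
  obtain ⟨c, rfl⟩ := (Submodule.mem_span_range_iff_exists_fun k).1
    (hf ▸ Submodule.mem_top : g ∈ Submodule.span k (Set.range f))
  refine ⟨∑ i, c i • LinearMap.proj i, ?_⟩
  ext w
  simp [LinearMap.sum_apply]

theorem exists_presentation [FiniteDimensional k A] [FiniteDimensional k W] :
    ∃ (p q : ℕ) (g : (Fin p → A) →ₗ[A] (Fin q → A)),
      Nonempty (((Fin q → A) ⧸ LinearMap.range g) ≃ₗ[A] W) := by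
  have : Module.Finite A W := Module.Finite.of_restrictScalars_finite k A W
  obtain ⟨q, f, hf⟩ := Module.Finite.exists_fin' A W
  have : Module.Finite k (LinearMap.ker f) :=
    inferInstanceAs (Module.Finite k ((LinearMap.ker f).restrictScalars k))
  have : Module.Finite A (LinearMap.ker f) :=
    Module.Finite.of_restrictScalars_finite k A _
  obtain ⟨p, g, hg⟩ := Module.Finite.exists_fin' A (LinearMap.ker f)
  refine ⟨p, q, (LinearMap.ker f).subtype ∘ₗ g, ⟨?_⟩⟩
  refine (Submodule.quotEquivOfEq _ (LinearMap.ker f) ?_).trans (f.quotKerEquivOfSurjective hf)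
  rw [LinearMap.range_comp, LinearMap.range_eq_top.2 hg, Submodule.map_top,
    Submodule.range_subtype]

theorem homPdLT_coker_of_gldimLE {A : Type} [Ring A] {X Y Z : Type} [AddCommGroup X] [Module A X]
    [AddCommGroup Y] [Module A Y] [AddCommGroup Z] [Module A Z] {c : ℕ}
    (h : gldimLE (Module.End A X) (c + 2)) (g : Y →ₗ[A] Z) (hY : HomProj (A := A) X Y)
    (hZ : HomProj (A := A) X Z) : HomPdLT (A := A) X (Z ⧸ LinearMap.range g) (c + 1) := by
  set R := LinearMap.range (precompEnd X g)
  have h1 := (pdLE_iff_pdLT _ _).1 (h ((Y →ₗ[A] X) ⧸ R) _ _)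
  have h2 := PdLT.ker R.mkQ_surjective ((pdLT_one_iff.2 hY).mono (by lia)) h1
  rw [Submodule.ker_mkQ] at h2
  have h3 := PdLT.ker (precompEnd X g).surjective_rangeRestrict
    ((pdLT_one_iff.2 hZ).mono (Nat.le_add_left 1 c)) h2
  rw [LinearMap.ker_rangeRestrict] at h3
  exact h3.congr (precompEnd_ker_equiv g).some.symm

theorem gldimLE_of_homPdLT [FiniteDimensional k X] {n : ℕ}
    (h : ∀ (l : ℕ) (g : X →ₗ[A] (Fin l → X)),
      HomPdLT (A := A) X ((Fin l → X) ⧸ LinearMap.range g) n) :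
    gldimLE (Module.End A X) (n + 1) := by
  refine gldimLE_of_cyclic _ fun I => ?_
  have : Module.Finite k (Module.End A X) := finite_linearMap k
  have : IsNoetherianRing (Module.End A X) := isNoetherian_of_tower k inferInstance
  obtain ⟨l, f, hf⟩ := Submodule.fg_iff_exists_fin_generating_family.1 (IsNoetherian.noetherian I)
  let g : X →ₗ[A] (Fin l → X) := LinearMap.pi f
  have hI (b : Module.End A X) : b ∈ I ↔ b ∈ LinearMap.range (precompEnd X g) := by
    rw [← hf, Submodule.mem_span_range_iff_exists_fun]
    constructor
    · rintro ⟨c, rfl⟩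
      refine ⟨∑ i, c i ∘ₗ LinearMap.proj i, ?_⟩
      ext x
      simp [LinearMap.sum_apply, g]
    · rintro ⟨c, rfl⟩
      refine ⟨fun i => c ∘ₗ LinearMap.single A (fun _ : Fin l => X) i, ?_⟩
      ext x
      simp only [smul_eq_mul, LinearMap.sum_apply, Module.End.mul_apply, LinearMap.comp_apply,
        ← map_sum, precompEnd_apply]
      congr 1
      exact LinearMap.sum_single_apply _ (g x)
  have h2 : PdLT (Module.End A X) (LinearMap.range (precompEnd X g)) (n + 1) := by
    refine PdLT.of_ker (precompEnd X g).surjective_rangeRestrict ?_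
      ((pdLT_one_iff.2 (homProj_self X).pi).mono (by lia))
    rw [LinearMap.ker_rangeRestrict]
    exact (h l g).congr (precompEnd_ker_equiv g).some
  refine PdLT.of_ker I.mkQ_surjective (h2.congr ?_)
    ((pdLT_one_iff.2 inferInstance).mono (by lia))
  exact
    { toFun := fun b => ⟨b.1, by simpa using (hI b.1).2 b.2⟩
      invFun := fun b => ⟨b.1, (hI b.1).1 (by simpa using b.2)⟩
      map_add' := fun _ _ => rfl
      map_smul' := fun _ _ => rfl
      left_inv := fun _ => rfl
      right_inv := fun _ => rfl }

end FiniteDimensional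

section Filtration

instance dualIsScalarTower {k : Type} [Field k] {A : Type} [Ring A] [Algebra k A] :
    IsScalarTower k A (A →ₗ[k] k) :=
  ⟨fun c a f => by ext x; simp [dualSMul_apply]⟩

/-- A multiplicative filtration of an augmented algebra whose last step is a simple
essential socle. -/
structure SocleFiltration (k : Type) [Field k] (A : Type) [Ring A] [Algebra k A] (n : ℕ) where
  F : ℕ → Submodule k A
  F_zero : F 0 = ⊤
  anti : Antitone F
  mul_mem : ∀ {i j : ℕ} {x y : A}, x ∈ F i → y ∈ F j → x * y ∈ F (i + j)
  last : F (n + 1) = ⊥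
  ε : A →ₗ[k] k
  sub_mem : ∀ a : A, a - algebraMap k A (ε a) ∈ F 1
  ω : A
  ω_mem : ω ∈ F n
  ω_ne_zero : ω ≠ 0
  socle : ∀ a : A, (∀ b ∈ F 1, b * a = 0) → ∃ c : k, a = c • ω

namespace SocleFiltration

variable {k : Type} [Field k] {A : Type} [Ring A] [Algebra k A] {n : ℕ}
  (S : SocleFiltration k A n)

/-- `S.Kills l W` says that the `l`-th step of the filtration annihilates `W`. -/
def Kills (l : ℕ) (W : Type) [AddCommGroup W] [Module A W] : Prop :=
  ∀ a ∈ S.F l, ∀ w : W, a • w = 0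

/-- The functionals on `A` vanishing on the `i`-th step of the filtration. -/
def dualStep (i : ℕ) : Submodule A (A →ₗ[k] k) where
  carrier := {f | ∀ x ∈ S.F i, f x = 0}
  add_mem' hf hg x hx := by simp [hf x hx, hg x hx]
  zero_mem' := by simp
  smul_mem' a f hf x hx :=
    hf _ (by simpa using S.mul_mem hx (S.F_zero.symm ▸ Submodule.mem_top : a ∈ S.F 0))

/-- `dualStep` as a type. -/
def DualStep (i : ℕ) : Type := S.dualStep i

instance (i : ℕ) : AddCommGroup (S.DualStep i) := inferInstanceAs (AddCommGroup (S.dualStep i))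

instance (i : ℕ) : Module A (S.DualStep i) := inferInstanceAs (Module A (S.dualStep i))

instance (i : ℕ) : Module k (S.DualStep i) := inferInstanceAs (Module k (S.dualStep i))

instance (i : ℕ) : IsScalarTower k A (S.DualStep i) :=
  inferInstanceAs (IsScalarTower k A (S.dualStep i))

instance [FiniteDimensional k A] (i : ℕ) : FiniteDimensional k (S.DualStep i) :=
  inferInstanceAs (FiniteDimensional k ((S.dualStep i).restrictScalars k))

/-- The embedding of a dual step in the dual. -/
def DualStep.val (i : ℕ) : S.DualStep i →ₗ[A] (A →ₗ[k] k) := (S.dualStep i).subtype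

theorem DualStep.val_injective (i : ℕ) : Function.Injective (DualStep.val S i) :=
  (S.dualStep i).injective_subtype

theorem DualStep.val_apply_eq_zero {i : ℕ} (f : S.DualStep i) {x : A} (hx : x ∈ S.F i) :
    DualStep.val S i f x = 0 := f.2 x hx

/-- A map to `A*` whose functional vanishes on `F_i W` lands in the `i`-th dual step. -/
def toDualStep {W : Type} [AddCommGroup W] [Module A W] (i : ℕ) (g : W →ₗ[A] (A →ₗ[k] k))
    (h : ∀ a ∈ S.F i, ∀ w : W, g w a = 0) : W →ₗ[A] S.DualStep i :=
  g.codRestrict (S.dualStep i) fun w a ha => h a ha w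

@[simp] theorem val_toDualStep {W : Type} [AddCommGroup W] [Module A W] (i : ℕ)
    (g : W →ₗ[A] (A →ₗ[k] k)) (h : ∀ a ∈ S.F i, ∀ w : W, g w a = 0) (w : W) :
    DualStep.val S i (S.toDualStep i g h w) = g w := rfl

/-- The sum of the first `l` steps of the dual filtration. -/
abbrev DualSum (l : ℕ) : Type := (i : Fin l) → S.DualStep i

theorem kills_dualStep {i l : ℕ} (h : i ≤ l) : S.Kills l (S.DualStep i) := by
  intro a ha f
  apply DualStep.val_injective
  ext x
  have : x * a ∈ S.F (0 + l) := S.mul_mem (S.F_zero.symm ▸ Submodule.mem_top) ha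
  rw [map_smul, map_zero]
  exact DualStep.val_apply_eq_zero S f (S.anti (by lia) this)

theorem kills_dualSum (l : ℕ) : S.Kills l (S.DualSum (l + 1)) := by
  intro a ha f
  ext1 i
  exact S.kills_dualStep (by lia) a ha (f i)

/-- The module whose endomorphism ring realizes the representation dimension. -/
abbrev Generator : Type := A × (A →ₗ[k] k) × S.DualSum (n + 1)

variable {W : Type} [AddCommGroup W] [Module A W] [Module k W] [IsScalarTower k A W]

theorem smul_eq {w : W} (hw : ∀ b ∈ S.F 1, b • w = 0) (a : A) : a • w = S.ε a • w := by
  have := hw _ (S.sub_mem a)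
  rwa [sub_smul, sub_eq_zero, algebraMap_smul] at this

/-- Every nonzero vector of `A^m` has a nonzero multiple in the socle. -/
theorem exists_smul_socle {m : ℕ} {x : Fin m → A} (hx : x ≠ 0) :
    ∃ (b : A) (c : Fin m → k), b • x = (fun i => c i • S.ω) ∧ c ≠ 0 := by
  classical
  have h0 : ∃ i, ∀ b ∈ S.F i, b • x = 0 :=
    ⟨n + 1, fun b hb => by rw [S.last, Submodule.mem_bot] at hb; rw [hb, zero_smul]⟩
  obtain ⟨i, hi⟩ : ∃ i, Nat.find h0 = i + 1 := by
    refine Nat.exists_eq_succ_of_ne_zero fun h => hx ?_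
    have := Nat.find_spec h0 1 (by rw [h, S.F_zero]; trivial)
    rwa [one_smul] at this
  have h1 := Nat.find_min h0 (m := i) (by lia)
  push Not at h1
  obtain ⟨b, hb, hbx⟩ := h1
  have h2 : ∀ j, ∃ c : k, (b • x) j = c • S.ω := fun j => S.socle _ fun b' hb' => by
    have h3 := Nat.find_spec h0 (b' * b) (by rw [hi, add_comm]; exact S.mul_mem hb' hb)
    rw [mul_smul] at h3
    exact congrFun h3 j
  choose c hc using h2
  refine ⟨b, c, funext hc, fun h => hbx ?_⟩
  ext j
  rw [hc, h]
  simp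

/-- If the `φ i` and `w i` are dual with respect to the action of the socle, then the map
`W → (A*)^m` defined by the `φ i` is a split surjection. -/
theorem exists_section [FiniteDimensional k A] {m : ℕ} (φ : Fin m → W →ₗ[k] k) (w : Fin m → W)
    (h : ∀ i j, φ i (S.ω • w j) = if i = j then 1 else 0) :
    ∃ s : (Fin m → (A →ₗ[k] k)) →ₗ[A] W,
      (LinearMap.pi fun i => toDual (φ i)) ∘ₗ s = LinearMap.id := by
  let p : (Fin m → A) →ₗ[A] W := Fintype.linearCombination A w
  let u : W →ₗ[A] (Fin m → (A →ₗ[k] k)) := LinearMap.pi fun i => toDual (φ i)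
  have hinj : Function.Injective (u ∘ₗ p) := by
    rw [← LinearMap.ker_eq_bot, LinearMap.ker_eq_bot']
    intro x hx
    by_contra hx0
    obtain ⟨b, c, hb, hc⟩ := S.exists_smul_socle hx0
    refine hc (funext fun i => ?_)
    have h1 : u (p (b • x)) = 0 := by
      have := congrArg (b • ·) hx
      simpa using this
    have h2 := LinearMap.congr_fun (congrFun h1 i) 1
    rw [hb] at h2
    have h3 (j : Fin m) : (S.ω • toDual (φ i) (w j)) (1 : A) = if i = j then 1 else 0 := by
      rw [← map_smul, toDual_apply, one_smul, h]
    simpa [u, p, Fintype.linearCombination_apply, smul_assoc, h3] using h2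
  have hdim : Module.finrank k (Fin m → A) = Module.finrank k (Fin m → (A →ₗ[k] k)) := by
    have : Module.finrank k (A →ₗ[k] k) = Module.finrank k A := Subspace.dual_finrank_eq
    rw [Module.finrank_pi_fintype, Module.finrank_pi_fintype, this]
  have hsurj : Function.Surjective (u ∘ₗ p) :=
    (LinearMap.injective_iff_surjective_of_finrank_eq_finrank
      (f := (u ∘ₗ p).restrictScalars k) hdim).1 hinj
  let e := LinearEquiv.ofBijective (u ∘ₗ p) ⟨hinj, hsurj⟩
  refine ⟨p ∘ₗ e.symm.toLinearMap, ?_⟩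
  exact LinearMap.ext fun f => e.apply_symm_apply f

/-- Such an algebra is Frobenius. -/
theorem exists_equiv_dual [FiniteDimensional k A] (S : SocleFiltration k A n) :
    Nonempty (A ≃ₗ[A] (A →ₗ[k] k)) := by
  obtain ⟨φ, hφ⟩ : ∃ φ : A →ₗ[k] k, φ S.ω ≠ 0 := by
    by_contra! h
    exact S.ω_ne_zero ((Module.forall_dual_apply_eq_zero_iff k S.ω).1 h)
  obtain ⟨s, hs⟩ := S.exists_section (fun _ : Fin 1 => (φ S.ω)⁻¹ • φ) (fun _ => 1) (by
    intro i j
    rw [if_pos (Subsingleton.elim i j)]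
    simp [hφ])
  have h1 : Function.Surjective (toDual ((φ S.ω)⁻¹ • φ) : A →ₗ[A] (A →ₗ[k] k)) := by
    intro f
    exact ⟨s fun _ => f, congrFun (LinearMap.congr_fun hs fun _ => f) 0⟩
  have h2 := (LinearMap.injective_iff_surjective_of_finrank_eq_finrank
    (f := (toDual ((φ S.ω)⁻¹ • φ) : A →ₗ[A] (A →ₗ[k] k)).restrictScalars k)
    Subspace.dual_finrank_eq.symm).2 h1
  exact ⟨LinearEquiv.ofBijective _ ⟨h2, h1⟩⟩

end SocleFiltration

end Filtration

section Extends

variable {A : Type} [Ring A] {W P T T' : Type} [AddCommGroup W] [Module A W]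
  [AddCommGroup P] [Module A P] [AddCommGroup T] [Module A T] [AddCommGroup T'] [Module A T']

/-- Every map from `W` to `T` factors through `u`. -/
def Extends (u : W →ₗ[A] P) (T : Type) [AddCommGroup T] [Module A T] : Prop :=
  ∀ g : W →ₗ[A] T, ∃ h : P →ₗ[A] T, h ∘ₗ u = g

variable {u : W →ₗ[A] P}

theorem Extends.retract (h : Extends u T) (i : T' →ₗ[A] T) (r : T →ₗ[A] T')
    (hr : r ∘ₗ i = LinearMap.id) : Extends u T' := by
  intro g
  obtain ⟨f, hf⟩ := h (i ∘ₗ g)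
  exact ⟨r ∘ₗ f, by rw [LinearMap.comp_assoc, hf, ← LinearMap.comp_assoc, hr, LinearMap.id_comp]⟩

theorem Extends.prod (h : Extends u T) (h' : Extends u T') : Extends u (T × T') := by
  intro g
  obtain ⟨f, hf⟩ := h (LinearMap.fst A T T' ∘ₗ g)
  obtain ⟨f', hf'⟩ := h' (LinearMap.snd A T T' ∘ₗ g)
  refine ⟨f.prod f', ?_⟩
  ext w
  · exact LinearMap.congr_fun hf w
  · exact LinearMap.congr_fun hf' w

theorem Extends.pi {ι : Type} {T : ι → Type} [∀ i, AddCommGroup (T i)] [∀ i, Module A (T i)]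
    (h : ∀ i, Extends u (T i)) : Extends u ((i : ι) → T i) := by
  intro g
  choose f hf using fun i => h i (LinearMap.proj i ∘ₗ g)
  refine ⟨LinearMap.pi f, ?_⟩
  ext w i
  exact LinearMap.congr_fun (hf i) w

end Extends

section Projections

variable {A : Type} [Ring A] {ι : Type} [DecidableEq ι] {T : ι → Type}
  [∀ i, AddCommGroup (T i)] [∀ i, Module A (T i)]

theorem LinearMap.proj_comp_single_self (i : ι) :
    (LinearMap.proj i : ((i : ι) → T i) →ₗ[A] T i) ∘ₗ LinearMap.single A T i = LinearMap.id := by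
  ext x
  simp

end Projections

namespace SocleFiltration

variable {k : Type} [Field k] {A : Type} [Ring A] [Algebra k A] {n : ℕ}
  (S : SocleFiltration k A n) {W : Type} [AddCommGroup W] [Module A W] [Module k W]
  [IsScalarTower k A W]

theorem exists_dual_family [FiniteDimensional k W] (V : Submodule k W) :
    ∃ (m : ℕ) (φ : Fin m → W →ₗ[k] k) (w : Fin m → W), (∀ i, w i ∈ V) ∧
      (∀ i j, φ i (w j) = if i = j then 1 else 0) ∧
      ∀ ψ : W →ₗ[k] k, ∀ v ∈ V, ψ v = ∑ i, ψ (w i) * φ i v := by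
  obtain ⟨p, hp⟩ := V.subtype.exists_leftInverse_of_injective (Submodule.ker_subtype V)
  have hp' (v : V) : p v = v := LinearMap.congr_fun hp v
  let b := Module.finBasis k V
  refine ⟨_, fun i => b.coord i ∘ₗ p, fun i => b i, fun i => (b i).2, fun i j => ?_,
    fun ψ v hv => ?_⟩
  · simp [hp', Finsupp.single_apply, eq_comm]
  · have h1 := congrArg (fun x : V => ψ x) (b.sum_repr ⟨v, hv⟩)
    have h2 := hp' ⟨v, hv⟩
    simp only [] at h2
    simp only [LinearMap.comp_apply, h2]
    refine h1.symm.trans ?_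
    simp [-Module.Basis.sum_repr, mul_comm]

theorem exists_approximation [FiniteDimensional k A] [FiniteDimensional k W] {l : ℕ}
    (hW : S.Kills (l + 1) W) :
    ∃ (m m' : ℕ) (u : W →ₗ[A] (Fin m → S.DualStep (l + 1)) × (Fin m' → S.DualSum (l + 1))),
      Extends u S.Generator ∧ S.Kills l
        (((Fin m → S.DualStep (l + 1)) × (Fin m' → S.DualSum (l + 1))) ⧸ LinearMap.range u) := by
  let V : Submodule k W := Submodule.span k {v | ∃ a ∈ S.F l, ∃ w : W, v = a • w}
  obtain ⟨m, φ, w, hw, hφ, hV⟩ := exists_dual_family V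
  obtain ⟨m', u₂, hu₂⟩ := exists_left_approximation k (A := A) (W := W) (Z := S.DualSum (l + 1))
  let u₁ : W →ₗ[A] (Fin m → S.DualStep (l + 1)) :=
    LinearMap.pi fun i => S.toDualStep (l + 1) (toDual (φ i)) fun a ha w => by
      rw [toDual_apply, hW a ha w, map_zero]
  have hu₁ (x : W) (i : Fin m) (a : A) : DualStep.val S _ (u₁ x i) a = φ i (a • x) := rfl
  have hVkill : ∀ v ∈ V, ∀ b ∈ S.F 1, b • v = 0 := by
    intro v hv b hb
    induction hv using Submodule.span_induction with
    | mem x hx =>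
      obtain ⟨a, ha, w, rfl⟩ := hx
      rw [← mul_smul]
      exact hW _ (add_comm 1 l ▸ S.mul_mem hb ha) w
    | zero => simp
    | add x y _ _ hx hy => rw [smul_add, hx, hy, add_zero]
    | smul c x _ hx => rw [smul_comm, hx, smul_zero]
  have hu₂V : ∀ v ∈ V, u₂ v = 0 := by
    intro v hv
    induction hv using Submodule.span_induction with
    | mem x hx =>
      obtain ⟨a, ha, w, rfl⟩ := hx
      rw [map_smul]
      ext1 i
      exact S.kills_dualSum l a ha _
    | zero => simp
    | add x y _ _ hx hy => rw [map_add, hx, hy, add_zero]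
    | smul c x _ hx => rw [LinearMap.map_smul_of_tower, hx, smul_zero]
  refine ⟨m, m', u₁.prod u₂, ?_, ?_⟩
  · have hsum : Extends (u₁.prod u₂) (S.DualSum (l + 1)) := by
      intro g
      obtain ⟨h, rfl⟩ := hu₂ g
      exact ⟨h ∘ₗ LinearMap.snd _ _ _, by ext; simp⟩
    have hlow (i : ℕ) (hi : i ≤ l) : Extends (u₁.prod u₂) (S.DualStep i) :=
      hsum.retract (LinearMap.single A (fun j : Fin (l + 1) => S.DualStep j) ⟨i, by lia⟩)
        (LinearMap.proj (φ := fun j : Fin (l + 1) => S.DualStep j) ⟨i, by lia⟩)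
        (LinearMap.proj_comp_single_self _)
    have hdual (ψ : W →ₗ[k] k) : ∃ h : (Fin m → S.DualStep (l + 1)) × (Fin m' → S.DualSum (l + 1))
        →ₗ[A] S.DualStep (l + 1), ∀ w, DualStep.val S _ (h ((u₁.prod u₂) w)) = toDual ψ w := by
      let ψ' : W →ₗ[k] k := ψ - ∑ i, ψ (w i) • φ i
      have hψ' : ∀ a ∈ S.F l, ∀ w : W, ψ' (a • w) = 0 := by
        intro a ha x
        have := hV ψ (a • x) (Submodule.subset_span ⟨a, ha, x, rfl⟩)
        simp [ψ', this, LinearMap.sum_apply]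
      obtain ⟨h, hh⟩ := hlow l le_rfl (S.toDualStep l (toDual ψ') hψ')
      refine ⟨(∑ i, ψ (w i) • LinearMap.proj i) ∘ₗ LinearMap.fst _ _ _ +
        S.toDualStep (l + 1) (DualStep.val S l ∘ₗ h) fun a ha w =>
          DualStep.val_apply_eq_zero S _ (S.anti (Nat.le_succ l) ha), fun x => ?_⟩
      ext a
      have h1 : DualStep.val S l (h (u₁ x, u₂ x)) a = ψ' (a • x) :=
        congrArg (fun t => DualStep.val S l t a) (LinearMap.congr_fun hh x)
      simp [LinearMap.sum_apply, h1, LinearMap.map_smul_of_tower, hu₁]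
      simp [ψ', LinearMap.sum_apply]
    have hstep (i : ℕ) : Extends (u₁.prod u₂) (S.DualStep i) := by
      rcases Nat.lt_or_ge l i with hi | hi
      · intro g
        obtain ⟨h, hh⟩ := hdual (LinearMap.applyₗ (1 : A) ∘ₗ
          (DualStep.val S i ∘ₗ g).restrictScalars k)
        refine ⟨S.toDualStep i (DualStep.val S _ ∘ₗ h) fun a ha w =>
          DualStep.val_apply_eq_zero S _ (S.anti hi ha), ?_⟩
        ext1 x
        apply DualStep.val_injective
        ext a
        have := LinearMap.congr_fun (hh x) a
        simp only [LinearMap.comp_apply, val_toDualStep]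
        rw [this]
        simp [dualSMul_apply]
      · exact hlow i hi
    have hA' : Extends (u₁.prod u₂) (A →ₗ[k] k) := by
      intro g
      obtain ⟨h, hh⟩ := hdual (LinearMap.applyₗ (1 : A) ∘ₗ g.restrictScalars k)
      refine ⟨DualStep.val S (l + 1) ∘ₗ h, ?_⟩
      ext x a
      have := LinearMap.congr_fun (hh x) a
      simp only [LinearMap.comp_apply]
      rw [this]
      simp [dualSMul_apply]
    obtain ⟨e⟩ := S.exists_equiv_dual
    exact (hA'.retract e.toLinearMap e.symm.toLinearMap (by ext; simp)).prod
      (hA'.prod (Extends.pi fun i => hstep i))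
  · intro a ha q
    obtain ⟨⟨f, z⟩, rfl⟩ := Submodule.mkQ_surjective _ q
    rw [← map_smul, Submodule.mkQ_apply, Submodule.Quotient.mk_eq_zero]
    have hv : ∑ j, DualStep.val S _ (f j) a • w j ∈ V :=
      Submodule.sum_mem _ fun j _ => V.smul_mem _ (hw j)
    refine ⟨∑ j, DualStep.val S _ (f j) a • w j, Prod.ext (funext fun i => ?_) ?_⟩
    · apply DualStep.val_injective
      ext x
      have h1 := DualStep.val_apply_eq_zero S (f i) (add_comm 1 l ▸ S.mul_mem (S.sub_mem x) ha)
      rw [sub_mul, map_sub, sub_eq_zero, ← Algebra.smul_def, map_smul] at h1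
      change DualStep.val S _ (u₁ _ i) x = (a • DualStep.val S _ (f i)) x
      rw [hu₁, S.smul_eq (hVkill _ hv), dualSMul_apply, h1]
      simp [hφ]
    · refine (hu₂V _ hv).trans (funext fun i => ?_)
      exact (S.kills_dualSum l a ha (z i)).symm

end SocleFiltration

namespace SocleFiltration

variable {k : Type} [Field k] {A : Type} [Ring A] [Algebra k A] {n : ℕ}
  (S : SocleFiltration k A n)

theorem homProj_dualStep {i : ℕ} (hi : i ≤ n) :
    HomProj (A := A) S.Generator (S.DualStep i) :=
  (homProj_self S.Generator).retract
    (LinearMap.inr A A ((A →ₗ[k] k) × S.DualSum (n + 1)) ∘ₗ LinearMap.inr A (A →ₗ[k] k) _ ∘ₗ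
      LinearMap.single A (fun j : Fin (n + 1) => S.DualStep j) ⟨i, by lia⟩)
    (LinearMap.proj (φ := fun j : Fin (n + 1) => S.DualStep j) ⟨i, by lia⟩ ∘ₗ
      LinearMap.snd A (A →ₗ[k] k) _ ∘ₗ LinearMap.snd A A _) (by
    ext1 x
    simp)

theorem homProj_dualSum {l : ℕ} (hl : l ≤ n + 1) :
    HomProj (A := A) S.Generator (S.DualSum l) := by
  let j : S.DualSum l →ₗ[A] S.DualSum (n + 1) := LinearMap.pi fun i =>
    if h : i.1 < l then LinearMap.proj (φ := fun j : Fin l => S.DualStep j) ⟨i.1, h⟩ else 0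
  let r : S.DualSum (n + 1) →ₗ[A] S.DualSum l := LinearMap.pi fun i =>
    LinearMap.proj (φ := fun j : Fin (n + 1) => S.DualStep j) ⟨i.1, by lia⟩
  refine (homProj_self S.Generator).retract
    (LinearMap.inr A A ((A →ₗ[k] k) × S.DualSum (n + 1)) ∘ₗ
      LinearMap.inr A (A →ₗ[k] k) _ ∘ₗ j)
    (r ∘ₗ LinearMap.snd A (A →ₗ[k] k) _ ∘ₗ LinearMap.snd A A _) ?_
  refine LinearMap.ext fun x => funext fun i => ?_
  simp [j, r]

theorem homPdLT_of_kills [FiniteDimensional k A] (l : ℕ) (hl : l ≤ n) (W : Type)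
    [AddCommGroup W] [Module A W] [Module k W] [IsScalarTower k A W] [FiniteDimensional k W]
    (hW : S.Kills l W) : HomPdLT (A := A) S.Generator W l := by
  induction l generalizing W with
  | zero =>
    have h0 (w : W) : w = 0 := by
      rw [← one_smul A w]
      exact hW 1 (S.F_zero.symm ▸ Submodule.mem_top) w
    have : Subsingleton (W →ₗ[A] S.Generator) :=
      ⟨fun f g => LinearMap.ext fun w => by rw [h0 w, map_zero, map_zero]⟩
    exact pdLT_zero_of_subsingleton
  | succ l ih =>
    obtain ⟨m, m', u, hu, hk⟩ := S.exists_approximation hW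
    exact HomPdLT.of_approx u hu
      ((S.homProj_dualStep hl).pi.prod (S.homProj_dualSum (by lia)).pi) (ih (by lia) _ hk)

theorem homPdLT_of_pos [FiniteDimensional k A] (hn : 0 < n) (W : Type)
    [AddCommGroup W] [Module A W] [Module k W] [IsScalarTower k A W] [FiniteDimensional k W] :
    HomPdLT (A := A) S.Generator W n := by
  let V : Submodule k W := LinearMap.range (Algebra.lsmul k k W S.ω)
  obtain ⟨m, φ, v, hv, hφ, hV⟩ := exists_dual_family V
  choose w hw using hv
  obtain ⟨s, hs⟩ := S.exists_section φ w fun i j => (congrArg (φ i) (hw j)).trans (hφ i j)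
  let u : W →ₗ[A] (Fin m → (A →ₗ[k] k)) := LinearMap.pi fun i => toDual (φ i)
  let K := LinearMap.ker u
  have : FiniteDimensional k K := inferInstanceAs (FiniteDimensional k (K.restrictScalars k))
  have hK : S.Kills n K := by
    intro a ha x
    obtain ⟨c, rfl⟩ := S.socle a fun b hb => by
      have := S.mul_mem hb ha
      rwa [add_comm, S.last, Submodule.mem_bot] at this
    have h0 : S.ω • (x : W) = 0 := by
      refine (Module.forall_dual_apply_eq_zero_iff k _).1 fun ψ => ?_
      rw [hV ψ (S.ω • (x : W)) ⟨x, rfl⟩]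
      refine Finset.sum_eq_zero fun i _ => ?_
      have : φ i (S.ω • (x : W)) = 0 :=
        LinearMap.congr_fun (congrFun (LinearMap.mem_ker.1 x.2) i) S.ω
      rw [this, mul_zero]
    ext
    simp [smul_assoc, h0]
  have hsu (y) : u (s y) = y := LinearMap.congr_fun hs y
  let r : W →ₗ[A] K := (LinearMap.id - s ∘ₗ u).codRestrict K fun x => by
    simp [K, hsu]
  have hr : r ∘ₗ K.subtype = LinearMap.id := by
    ext x
    have : u x = 0 := x.2
    simp [r, this]
  have hsurj : Function.Surjective (precompEnd S.Generator K.subtype) := fun g =>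
    ⟨g ∘ₗ r, by rw [precompEnd_apply, LinearMap.comp_assoc, hr, LinearMap.comp_id]⟩
  refine PdLT.middle hsurj ?_ (S.homPdLT_of_kills n le_rfl K hK)
  refine ((pdLT_one_iff.2 ?_).congr (precompEnd_ker_equiv K.subtype).some).mono hn
  have hA : HomProj (A := A) S.Generator (A →ₗ[k] k) :=
    (homProj_self S.Generator).retract
      (LinearMap.inr A A _ ∘ₗ LinearMap.inl A (A →ₗ[k] k) (S.DualSum (n + 1)))
      (LinearMap.fst A _ _ ∘ₗ LinearMap.snd A A _) (by ext1; simp)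
  refine (hA.pi (m := m)).equiv ((Submodule.quotEquivOfEq _ K (Submodule.range_subtype K)).trans
    (u.quotKerEquivOfSurjective fun y => ⟨s y, hsu y⟩))

/-- Upper bound for the representation dimension. -/
theorem gldimLE_end_generator [FiniteDimensional k A] (hn : 0 < n) :
    gldimLE (Module.End A S.Generator) (n + 1) :=
  gldimLE_of_homPdLT k fun _ _ => S.homPdLT_of_pos hn _

end SocleFiltration

section ExteriorFiltration

open ExteriorAlgebra

variable {k : Type} [Field k] {n : ℕ}

variable (k n) in
/-- The standard basis of the exterior algebra of `k^n`. -/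
noncomputable def extBasis : Module.Basis (Finset (Fin n)) k (ExteriorAlgebra k (Fin n → k)) :=
  (Pi.basisFun k (Fin n)).ExteriorAlgebra

instance finiteDimensional_exteriorAlgebra :
    FiniteDimensional k (ExteriorAlgebra k (Fin n → k)) :=
  Module.Finite.of_basis (extBasis k n)

theorem extBasis_mul_of_not_disjoint {s t : Finset (Fin n)} (h : ¬Disjoint s t) :
    extBasis k n s * extBasis k n t = 0 :=
  basis_mul_of_not_disjoint (Pi.basisFun k (Fin n)) (⟨s, rfl⟩ : Set.powersetCard (Fin n) s.card)
    (⟨t, rfl⟩ : Set.powersetCard (Fin n) t.card) h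

theorem extBasis_mul_of_disjoint {s t : Finset (Fin n)} (h : Disjoint s t) :
    ∃ c : k, c ≠ 0 ∧ extBasis k n s * extBasis k n t = c • extBasis k n (s ∪ t) := by
  have h1 := basis_mul_of_disjoint (Pi.basisFun k (Fin n))
    (⟨s, rfl⟩ : Set.powersetCard (Fin n) s.card) (⟨t, rfl⟩ : Set.powersetCard (Fin n) t.card) h
  refine ⟨((Set.powersetCard.permOfDisjoint (s := (⟨s, rfl⟩ : Set.powersetCard (Fin n) s.card))
    (t := (⟨t, rfl⟩ : Set.powersetCard (Fin n) t.card)) h).sign : ℤ), ?_, h1.trans ?_⟩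
  · rcases Int.units_eq_one_or (Equiv.Perm.sign (Set.powersetCard.permOfDisjoint
      (s := (⟨s, rfl⟩ : Set.powersetCard (Fin n) s.card))
      (t := (⟨t, rfl⟩ : Set.powersetCard (Fin n) t.card)) h)) with h | h <;> simp [h]
  · rw [Int.cast_smul_eq_zsmul, Units.smul_def]
    congr 2
    simp [Set.powersetCard.disjUnion]

theorem extBasis_empty : extBasis k n ∅ = 1 := by
  have := basis_apply (Pi.basisFun k (Fin n)) ∅
  rw [extBasis, this]
  exact ιMulti_zero_apply _

theorem extBasis_singleton (i : Fin n) : extBasis k n {i} = ι k (Pi.single i 1) := by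
  rw [extBasis, basis_apply_ofCard (n := 1) _ (by simp)]
  simp only [ιMulti_family, ιMulti_apply, List.ofFn_succ, List.ofFn_zero, List.prod_cons,
    List.prod_nil, mul_one, Function.comp_apply, Pi.basisFun_apply]
  congr 2
  exact Finset.mem_singleton.1 (Finset.orderEmbOfFin_mem ({i} : Finset (Fin n)) (by simp) 0)

theorem extBasis_mul_mem {i j : ℕ} {x y : ExteriorAlgebra k (Fin n → k)}
    (hx : x ∈ Submodule.span k (extBasis k n '' {s | i ≤ s.card}))
    (hy : y ∈ Submodule.span k (extBasis k n '' {s | j ≤ s.card})) :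
    x * y ∈ Submodule.span k (extBasis k n '' {s | i + j ≤ s.card}) := by
  have h := Submodule.mul_mem_mul hx hy
  rw [Submodule.span_mul_span] at h
  refine Submodule.span_le.2 ?_ h
  rintro _ ⟨_, ⟨s, hs, rfl⟩, _, ⟨t, ht, rfl⟩, rfl⟩
  by_cases hst : Disjoint s t
  · obtain ⟨c, -, hc⟩ := extBasis_mul_of_disjoint (k := k) hst
    simp only [hc]
    refine Submodule.smul_mem _ _ (Submodule.subset_span ⟨_, ?_, rfl⟩)
    rw [Set.mem_ofPred_eq, Finset.card_union_of_disjoint hst]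
    exact add_le_add hs ht
  · simp only [extBasis_mul_of_not_disjoint hst]
    exact Submodule.zero_mem _

variable (k n) in
/-- The filtration of the exterior algebra by the powers of the augmentation ideal. -/
noncomputable def extFiltration : SocleFiltration k (ExteriorAlgebra k (Fin n → k)) n where
  F i := Submodule.span k (extBasis k n '' {s | i ≤ s.card})
  F_zero := by
    simp [Module.Basis.span_eq]
  anti i j hij := Submodule.span_mono (Set.image_mono fun s hs => hij.trans hs)
  mul_mem := extBasis_mul_mem
  last := by
    rw [Submodule.span_eq_bot]
    rintro _ ⟨s, hs, rfl⟩
    have := s.card_le_univ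
    rw [Fintype.card_fin] at this
    exact absurd (hs.trans this) (by lia)
  ε := (extBasis k n).coord ∅
  sub_mem a := by
    have h : a = ∑ s, (extBasis k n).repr a s • extBasis k n s := ((extBasis k n).sum_repr a).symm
    rw [← Finset.add_sum_erase _ _ (Finset.mem_univ ∅), extBasis_empty,
      ← Algebra.algebraMap_eq_smul_one] at h
    have h2 : a - algebraMap k _ ((extBasis k n).coord ∅ a) =
        ∑ s ∈ Finset.univ.erase ∅, (extBasis k n).repr a s • extBasis k n s := by
      rw [sub_eq_iff_eq_add']
      exact h
    rw [h2]
    refine Submodule.sum_mem _ fun s hs => Submodule.smul_mem _ _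
      (Submodule.subset_span ⟨s, ?_, rfl⟩)
    exact Finset.card_pos.2 (Finset.nonempty_iff_ne_empty.2 (Finset.ne_of_mem_erase hs))
  ω := extBasis k n Finset.univ
  ω_mem := Submodule.subset_span ⟨_, by simp, rfl⟩
  ω_ne_zero := (extBasis k n).ne_zero _
  socle a ha := by
    refine ⟨(extBasis k n).repr a Finset.univ, ?_⟩
    have h : a = ∑ s, (extBasis k n).repr a s • extBasis k n s := ((extBasis k n).sum_repr a).symm
    rw [Finset.sum_eq_single Finset.univ] at h
    · exact h
    · intro t _ ht
      suffices h0 : (extBasis k n).repr a t = 0 by rw [h0, zero_smul]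
      obtain ⟨i, hi⟩ : ∃ i, i ∉ t := by
        by_contra! h
        exact ht (Finset.eq_univ_iff_forall.2 h)
      have h1 := ha _ (Submodule.subset_span ⟨{i}, by simp, rfl⟩)
      rw [← (extBasis k n).sum_repr a, Finset.mul_sum] at h1
      have h2 := congrArg (fun z => (extBasis k n).repr z ({i} ∪ t)) h1
      simp only [map_sum, Finsupp.finsetSum_apply, map_zero, Finsupp.zero_apply] at h2
      rw [Finset.sum_eq_single t] at h2
      · obtain ⟨c, hc0, hc⟩ := extBasis_mul_of_disjoint (k := k)
          (Finset.disjoint_singleton_left.2 hi)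
        rw [mul_smul_comm, hc] at h2
        simpa [hc0] using h2
      · intro s _ hs
        rw [mul_smul_comm]
        by_cases his : i ∈ s
        · rw [extBasis_mul_of_not_disjoint (by simpa using his)]
          simp
        · obtain ⟨c, hc0, hc⟩ := extBasis_mul_of_disjoint (k := k)
            (Finset.disjoint_singleton_left.2 his)
          rw [hc]
          have : {i} ∪ s ≠ {i} ∪ t := fun h => hs (by
            rw [← Finset.insert_eq, ← Finset.insert_eq] at h
            rw [← Finset.erase_insert his, h, Finset.erase_insert hi])
          rw [map_smul, map_smul, Module.Basis.repr_self, Finsupp.smul_apply, Finsupp.smul_single,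
            Finsupp.single_eq_of_ne this.symm, smul_zero]
      · simp
    · simp

end ExteriorFiltration

section Koszul

open TensorProduct

variable {k : Type} [Field k] {A : Type} [Ring A] [Algebra k A] {ι : Type} [Fintype ι]
  (e : ι → A) {S : Type} [CommRing S] [Algebra k S]
  {N : Type} [AddCommGroup N] [Module A N] [Module k N] [IsScalarTower k A N]
  {P : Type} [AddCommGroup P] [Module A P] [Module k P] [IsScalarTower k A P]

/-- The family `e` satisfies the relations of the generators of an exterior algebra. -/
structure Anticommuting (e : ι → A) : Prop where
  sq : ∀ l, e l * e l = 0
  swap : ∀ l m, e l * e m + e m * e l = 0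

/-- The action of `∑ s l ⊗ e l` on `S ⊗ N`. -/
noncomputable def koszul (N : Type) [AddCommGroup N] [Module A N] [Module k N]
    [IsScalarTower k A N] (s : ι → S) : (S ⊗[k] N) →ₗ[S] (S ⊗[k] N) :=
  ∑ l, s l • (Algebra.lsmul k k N (e l)).baseChange S

theorem koszul_tmul (s : ι → S) (x : S) (z : N) :
    koszul (k := k) e N s (x ⊗ₜ z) = ∑ l, (s l * x) ⊗ₜ[k] (e l • z) := by
  simp [koszul, LinearMap.sum_apply, smul_tmul']

theorem koszul_add (s s' : ι → S) (z : S ⊗[k] N) :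
    koszul e N (s + s') z = koszul e N s z + koszul e N s' z := by
  simp [koszul, LinearMap.sum_apply, add_smul, Finset.sum_add_distrib]

theorem koszul_smul (y : S) (s : ι → S) (z : S ⊗[k] N) :
    koszul e N (y • s) z = y • koszul e N s z := by
  simp [koszul, LinearMap.sum_apply, mul_smul, Finset.smul_sum]

theorem koszul_natural (f : N →ₗ[A] P) (s : ι → S) (z : S ⊗[k] N) :
    (f.restrictScalars k).baseChange S (koszul e N s z) =
      koszul e P s ((f.restrictScalars k).baseChange S z) := by
  induction z with
  | zero => simp
  | add x y hx hy => rw [map_add, map_add, hx, hy, map_add, map_add]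
  | tmul x z => simp [koszul_tmul, LinearMap.baseChange_tmul]

variable {e}

theorem koszul_swap (he : Anticommuting e) (s s' : ι → S) (z : S ⊗[k] N) :
    koszul e N s (koszul e N s' z) = -koszul e N s' (koszul e N s z) := by
  rw [eq_neg_iff_add_eq_zero]
  induction z with
  | zero => simp
  | add x y hx hy =>
    simp only [map_add]
    rw [add_add_add_comm, hx, hy, add_zero]
  | tmul x z =>
    simp only [koszul_tmul, map_sum]
    rw [Finset.sum_comm (f := fun l m => (s' m * (s l * x)) ⊗ₜ[k] (e m • e l • z)),
      ← Finset.sum_add_distrib]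
    refine Finset.sum_eq_zero fun l _ => ?_
    rw [← Finset.sum_add_distrib]
    refine Finset.sum_eq_zero fun m _ => ?_
    rw [mul_left_comm (s' l), ← tmul_add, ← mul_smul, ← mul_smul, ← add_smul, he.swap, zero_smul,
      tmul_zero]

theorem koszul_sq (he : Anticommuting e) (s : ι → S) (z : S ⊗[k] N) :
    koszul e N s (koszul e N s z) = 0 := by
  classical
  let E (l : ι) : (S ⊗[k] N) →ₗ[S] (S ⊗[k] N) := koszul e N (Pi.single l (s l))
  have hE (l : ι) (z : S ⊗[k] N) : E l z = s l • (Algebra.lsmul k k N (e l)).baseChange S z := by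
    simp only [E, koszul, LinearMap.sum_apply, LinearMap.smul_apply]
    rw [Finset.sum_eq_single l]
    · simp
    · intro m _ hm
      simp [Pi.single_eq_of_ne hm]
    · simp
  have hE2 (l : ι) (z : S ⊗[k] N) : E l (E l z) = 0 := by
    rw [hE, hE, map_smul, ← LinearMap.comp_apply, ← LinearMap.baseChange_comp]
    have : Algebra.lsmul k k N (e l) ∘ₗ Algebra.lsmul k k N (e l) = 0 := by
      ext z
      simp [← mul_smul, he.sq]
    simp [this]
  have key (T : Finset ι) : (∑ l ∈ T, E l) ∘ₗ (∑ l ∈ T, E l) = 0 := by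
    induction T using Finset.induction_on with
    | empty => simp
    | insert l T hl ih =>
      ext1
      ext z
      have h1 := LinearMap.congr_fun ih (1 ⊗ₜ z)
      have h2 : E l ((∑ m ∈ T, E m) (1 ⊗ₜ z)) + (∑ m ∈ T, E m) (E l (1 ⊗ₜ z)) = 0 := by
        simp only [LinearMap.sum_apply, map_sum]
        rw [← Finset.sum_add_distrib]
        exact Finset.sum_eq_zero fun m _ => by rw [koszul_swap he, neg_add_cancel]
      rw [Finset.sum_insert hl]
      simp only [LinearMap.comp_apply, LinearMap.zero_apply] at h1
      simp only [TensorProduct.AlgebraTensorModule.curry_apply, TensorProduct.curry_apply,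
        LinearMap.restrictScalars_apply, LinearMap.comp_apply, LinearMap.add_apply, map_add, hE2,
        h1, LinearMap.zero_apply, zero_add, add_zero] at h2 ⊢
      rw [add_comm]
      exact h2
  have h3 : koszul e N s = ∑ l, E l := by
    ext z
    simp [koszul, LinearMap.sum_apply, hE]
  rw [h3]
  exact LinearMap.congr_fun (key Finset.univ) z

/-- The composite of the operators attached to `v (i + j - 1), …, v i`. -/
noncomputable def koszulIter (e : ι → A) (N : Type) [AddCommGroup N] [Module A N] [Module k N]
    [IsScalarTower k A N] (v : ℕ → ι → S) : ℕ → ℕ → (S ⊗[k] N) →ₗ[S] (S ⊗[k] N)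
  | _, 0 => LinearMap.id
  | i, j + 1 => koszulIter e N v (i + 1) j ∘ₗ koszul e N (v i)

theorem koszulIter_natural (f : N →ₗ[A] P) (v : ℕ → ι → S) (i j : ℕ) (z : S ⊗[k] N) :
    (f.restrictScalars k).baseChange S (koszulIter e N v i j z) =
      koszulIter e P v i j ((f.restrictScalars k).baseChange S z) := by
  induction j generalizing i z with
  | zero => rfl
  | succ j ih => simp only [koszulIter, LinearMap.comp_apply, ih, koszul_natural]

theorem koszul_koszulIter (he : Anticommuting e) (v : ℕ → ι → S) (s : ι → S) (i j : ℕ)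
    (z : S ⊗[k] N) :
    koszul e N s (koszulIter e N v i j z) =
      (-1 : S) ^ j • koszulIter e N v i j (koszul e N s z) := by
  induction j generalizing i z with
  | zero => simp [koszulIter]
  | succ j ih =>
    simp only [koszulIter, LinearMap.comp_apply, ih]
    rw [koszul_swap he, map_neg, smul_neg, pow_succ, mul_neg_one]
    exact (neg_smul _ _).symm

theorem koszul_koszulIter_eq_zero (he : Anticommuting e) (v : ℕ → ι → S) (i j m : ℕ) (hi : i ≤ m)
    (hm : m < i + j) (z : S ⊗[k] N) : koszul e N (v m) (koszulIter e N v i j z) = 0 := by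
  induction j generalizing i z with
  | zero => lia
  | succ j ih =>
    simp only [koszulIter, LinearMap.comp_apply]
    rcases hi.eq_or_lt with rfl | hi
    · rw [koszul_koszulIter he, koszul_sq he, map_zero, smul_zero]
    · exact ih (i + 1) (by lia) (by lia) _

/-- The sequence of points starting at `s₀` and moving successively in the directions `v m`. -/
def pathSeq (s₀ : ι → S) (y : ℕ → S) (v : ℕ → ι → S) : ℕ → ι → S
  | 0 => s₀
  | m + 1 => pathSeq s₀ y v m + y m • v m

theorem koszul_pathSeq_koszulIter (he : Anticommuting e) (s₀ : ι → S) (y : ℕ → S) (v : ℕ → ι → S)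
    (i j p : ℕ) (hp : p ≤ j) (z : S ⊗[k] N) :
    koszul e N (pathSeq s₀ y v (i + p)) (koszulIter e N v i j z) =
      koszul e N (pathSeq s₀ y v i) (koszulIter e N v i j z) := by
  induction p with
  | zero => rfl
  | succ p ih =>
    rw [← add_assoc, pathSeq, koszul_add, koszul_smul,
      koszul_koszulIter_eq_zero he v i j (i + p) (by lia) (by lia), smul_zero, add_zero,
      ih (by lia)]

end Koszul

section Ghost

open TensorProduct

variable {k : Type} [Field k] {A : Type} [Ring A] [Algebra k A] {ι : Type} [Fintype ι]
  {e : ι → A} {S : Type} [CommRing S] [Algebra k S] {K : Type} [Field K] {κ : S →+* K}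
  {s₀ : ι → S} {y : ℕ → S} {v : ℕ → ι → S} {c j : ℕ}
  {N : Type} [AddCommGroup N] [Module A N] [Module k N] [IsScalarTower k A N]
  {P : Type} [AddCommGroup P] [Module A P] [Module k P] [IsScalarTower k A P]
  {Q : Type} [AddCommGroup Q] [Module A Q] [Module k Q] [IsScalarTower k A Q]

/-- Any `j` consecutive operators in the directions `v` map the cycles of the Koszul operator on
`S ⊗ N` to its boundaries, up to a factor which does not vanish under `κ`. -/
def GhostVanish (e : ι → A) (κ : S →+* K) (s₀ : ι → S) (y : ℕ → S) (v : ℕ → ι → S) (c j : ℕ)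
    (N : Type) [AddCommGroup N] [Module A N] [Module k N] [IsScalarTower k A N] : Prop :=
  ∀ i, i + j ≤ c → ∃ H : S, κ H ≠ 0 ∧ ∀ z : S ⊗[k] N, koszul e N (pathSeq s₀ y v i) z = 0 →
    ∃ t, H • koszulIter e N v i j z = koszul e N (pathSeq s₀ y v (i + j)) t

theorem GhostVanish.retract (h : GhostVanish (k := k) e κ s₀ y v c j P) (f : N →ₗ[A] P)
    (r : P →ₗ[A] N) (hr : r ∘ₗ f = LinearMap.id) : GhostVanish (k := k) e κ s₀ y v c j N := by
  intro i hi
  obtain ⟨H, hH, h⟩ := h i hi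
  refine ⟨H, hH, fun z hz => ?_⟩
  obtain ⟨t, ht⟩ := h ((f.restrictScalars k).baseChange S z)
    (by rw [← koszul_natural, hz, map_zero])
  refine ⟨(r.restrictScalars k).baseChange S t, ?_⟩
  have hrf : (r.restrictScalars k).baseChange S ((f.restrictScalars k).baseChange S z) = z := by
    rw [← LinearMap.comp_apply, ← LinearMap.baseChange_comp]
    have : r.restrictScalars k ∘ₗ f.restrictScalars k = LinearMap.id := by
      ext x
      exact LinearMap.congr_fun hr x
    rw [this, LinearMap.baseChange_id, LinearMap.id_apply]
  rw [← koszul_natural, ← ht, map_smul, koszulIter_natural, hrf]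

theorem GhostVanish.pi {m : ℕ} (h : GhostVanish (k := k) e κ s₀ y v c j N) :
    GhostVanish (k := k) e κ s₀ y v c j (Fin m → N) := by
  intro i hi
  obtain ⟨H, hH, h⟩ := h i hi
  refine ⟨H, hH, fun z hz => ?_⟩
  let p (l : Fin m) : (Fin m → N) →ₗ[A] N := LinearMap.proj l
  let q (l : Fin m) : N →ₗ[A] (Fin m → N) := LinearMap.single A (fun _ => N) l
  have hpq (z : S ⊗[k] (Fin m → N)) :
      ∑ l, ((q l).restrictScalars k).baseChange S
        (((p l).restrictScalars k).baseChange S z) = z := by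
    induction z with
    | zero => simp
    | add a b ha hb => simp only [map_add, Finset.sum_add_distrib, ha, hb]
    | tmul a b =>
      simp only [LinearMap.baseChange_tmul, ← tmul_sum]
      congr 1
      ext l
      simp [p, q, Finset.sum_apply, Pi.single_apply]
  choose t ht using fun l => h (((p l).restrictScalars k).baseChange S z)
    (by rw [← koszul_natural, hz, map_zero])
  refine ⟨∑ l, ((q l).restrictScalars k).baseChange S (t l), ?_⟩
  rw [map_sum]
  simp only [← koszul_natural, ← ht]
  rw [← hpq (H • koszulIter e _ v i j z)]
  simp only [map_smul, koszulIter_natural]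

theorem GhostVanish.step (he : Anticommuting e) (hP : GhostVanish (k := k) e κ s₀ y v c 1 P)
    (hQ : GhostVanish (k := k) e κ s₀ y v c j Q) (u : N →ₗ[A] P) (hu : Function.Injective u)
    (π : P →ₗ[A] Q) (hπ : Function.Surjective π) (huπ : Function.Exact u π) :
    GhostVanish (k := k) e κ s₀ y v c (j + 1) N := by
  intro i hi
  obtain ⟨H, hH, h⟩ := hP i (by lia)
  obtain ⟨H', hH', h'⟩ := hQ (i + 1) (by lia)
  refine ⟨H' * H, by simpa using ⟨hH', hH⟩, fun z hz => ?_⟩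
  set U := (u.restrictScalars k).baseChange S with hU
  set V := (π.restrictScalars k).baseChange S with hV
  have hUinj : Function.Injective U :=
    Module.Flat.lTensor_preserves_injective_linearMap (M := S) (u.restrictScalars k) hu
  have hVsurj : Function.Surjective V :=
    LinearMap.lTensor_surjective S (g := π.restrictScalars k) hπ
  have hexact : Function.Exact U V :=
    lTensor_exact S (f := u.restrictScalars k) (g := π.restrictScalars k) huπ hπ
  obtain ⟨w, hw⟩ := h (U z) (by rw [← koszul_natural, hz, map_zero])
  have hw : H • koszul e P (v i) (U z) = koszul e P (pathSeq s₀ y v (i + 1)) w := hw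
  obtain ⟨t, ht⟩ := h' (V w) (by
    rw [← koszul_natural, ← hw, map_smul, koszul_natural, ← hV, hexact.apply_apply_eq_zero,
      map_zero, smul_zero])
  obtain ⟨t, rfl⟩ := hVsurj t
  obtain ⟨b, hb⟩ := (hexact (H' • koszulIter e P v (i + 1) j w -
      koszul e P (pathSeq s₀ y v (i + 1 + j)) t)).1 (by
    rw [map_sub, map_smul, koszulIter_natural, koszul_natural, ← hV, ht, sub_self])
  have key := congrArg (koszul e P (pathSeq s₀ y v (i + 1 + j))) hb
  rw [map_sub, map_smul, koszul_sq he, sub_zero, koszul_pathSeq_koszulIter he _ _ _ _ _ _ le_rfl,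
    koszul_koszulIter he, ← hw, ← koszul_natural, map_smul] at key
  rw [← koszul_natural, ← koszulIter_natural, ← map_smul, ← map_smul, ← map_smul] at key
  have key := hUinj key
  refine ⟨(-1 : S) ^ j • b, ?_⟩
  have hij : i + (j + 1) = i + 1 + j := by lia
  rw [map_smul, hij, key, smul_comm H', smul_smul, smul_smul, ← mul_pow, neg_one_mul, neg_neg,
    one_pow, one_mul, smul_smul]
  rfl

end Ghost

section GenericInverse

open TensorProduct

theorem Matrix.exists_mul_mul_eq_smul {R : Type} [CommRing R] [IsDomain R] {ι : Type} [Fintype ι]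
    [DecidableEq ι] (M : Matrix ι ι R) :
    ∃ (Q : Matrix ι ι R) (h : R), h ≠ 0 ∧ M * Q * M = h • M := by
  let F := FractionRing R
  let f : (ι → F) →ₗ[F] (ι → F) := Matrix.toLin' (M.map (algebraMap R F))
  obtain ⟨g, hg⟩ := f.rangeRestrict.exists_rightInverse_of_surjective f.range_rangeRestrict
  obtain ⟨g', hg'⟩ := LinearMap.exists_extend g
  have hfg (x : ι → F) : f (g' (f x)) = f x := by
    have h1 : g' (f x) = g (f.rangeRestrict x) := LinearMap.congr_fun hg' (f.rangeRestrict x)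
    rw [h1]
    exact congrArg Subtype.val (LinearMap.congr_fun hg (f.rangeRestrict x))
  let G : Matrix ι ι F := LinearMap.toMatrix' g'
  have hG : M.map (algebraMap R F) * G * M.map (algebraMap R F) = M.map (algebraMap R F) := by
    apply Matrix.toLin'.injective
    rw [Matrix.toLin'_mul, Matrix.toLin'_mul, Matrix.toLin'_toMatrix']
    exact LinearMap.ext hfg
  obtain ⟨b, hb⟩ := IsLocalization.exist_integer_multiples_of_finite (nonZeroDivisors R)
    (fun p : ι × ι => G p.1 p.2)
  choose Q hQ using hb
  refine ⟨Matrix.of fun i j => Q (i, j), b, nonZeroDivisors.ne_zero b.2, ?_⟩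
  have hinj : Function.Injective (algebraMap R F) := IsFractionRing.injective R F
  apply Matrix.map_injective hinj
  have hQ' : (Matrix.of fun i j => Q (i, j)).map (algebraMap R F) = algebraMap R F b • G := by
    ext i j
    simpa [Algebra.smul_def] using hQ (i, j)
  beta_reduce
  rw [Matrix.map_mul, Matrix.map_mul, hQ', Matrix.mul_smul, Matrix.smul_mul, hG]
  ext i j
  simp

variable {k : Type} [Field k] {A : Type} [Ring A] [Algebra k A] {c : ℕ}
  {X : Type} [AddCommGroup X] [Module A X] [Module k X] [IsScalarTower k A X]

theorem exists_koszul_generic_inverse [FiniteDimensional k X] (e : Fin (c + 1) → A) :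
    ∃ h : MvPolynomial (Fin c) k, h ≠ 0 ∧ ∀ (S : Type) [CommRing S] [Algebra k S]
      (s : Fin (c + 1) → S), s 0 = 1 → ∃ Q : (S ⊗[k] X) →ₗ[S] (S ⊗[k] X), ∀ z,
        koszul e X s (Q (koszul e X s z)) =
          MvPolynomial.aeval (fun l => s l.succ) h • koszul e X s z := by
  classical
  let b := Module.finBasis k X
  let x : Fin (c + 1) → MvPolynomial (Fin c) k := Fin.cons 1 MvPolynomial.X
  let M := ∑ l, x l • (LinearMap.toMatrix b b (Algebra.lsmul k k X (e l))).map
    (algebraMap k (MvPolynomial (Fin c) k))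
  obtain ⟨Q, h, hh, hQ⟩ := M.exists_mul_mul_eq_smul
  refine ⟨h, hh, fun S _ _ s hs => ?_⟩
  let φ : MvPolynomial (Fin c) k →ₐ[k] S := MvPolynomial.aeval (fun l => s l.succ)
  have hx (l : Fin (c + 1)) : φ (x l) = s l := by
    refine Fin.cases ?_ (fun l => ?_) l
    · simp [x, hs]
    · simp [x, φ]
  let b' := b.baseChange S
  have hM : LinearMap.toMatrix b' b' (koszul e X s) = M.map φ := by
    simp only [koszul, map_sum, map_smul, b']
    ext i j
    simp [M, Matrix.sum_apply, hx, LinearMap.toMatrix_apply, Algebra.algebraMap_eq_smul_one]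
  refine ⟨Matrix.toLin b' b' (Q.map φ), fun z => ?_⟩
  have key : koszul e X s ∘ₗ Matrix.toLin b' b' (Q.map φ) ∘ₗ koszul e X s =
      φ h • koszul e X s := by
    apply (LinearMap.toMatrix b' b').injective
    rw [LinearMap.toMatrix_comp b' b' b', LinearMap.toMatrix_comp b' b' b',
      LinearMap.toMatrix_toLin, map_smul, hM, ← mul_assoc]
    have := congrArg (fun N : Matrix _ _ _ => N.map (φ : MvPolynomial (Fin c) k →+* S)) hQ
    simp only [Matrix.map_mul] at this
    refine this.trans ?_
    ext i j
    simp
  exact LinearMap.congr_fun key z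

end GenericInverse

section GhostData

open TensorProduct MvPolynomial

variable {k : Type} [Field k] {A : Type} [Ring A] [Algebra k A] {c : ℕ}
  {K : Type} [Field K] [Algebra k K]

/-- The point `(1, a)`, with coordinates viewed as constant polynomials. -/
noncomputable def ghostBase (a : Fin c → K) : Fin (c + 1) → MvPolynomial (Fin c) K :=
  Fin.cons 1 fun l => C (a l)

/-- The step lengths `X m`. -/
noncomputable def ghostStep (K : Type) [Field K] (c m : ℕ) : MvPolynomial (Fin c) K :=
  if h : m < c then X ⟨m, h⟩ else 0

/-- The coordinate directions, skipping the first one. -/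
noncomputable def ghostDir (K : Type) [Field K] (c m : ℕ) (l : Fin (c + 1)) :
    MvPolynomial (Fin c) K :=
  if (l : ℕ) = m + 1 then 1 else 0

/-- The vanishing condition for the path through the coordinate directions starting at `(1, a)`. -/
abbrev GhostVanishAt (e : Fin (c + 1) → A) (a : Fin c → K) (j : ℕ)
    (N : Type) [AddCommGroup N] [Module A N] [Module k N] [IsScalarTower k A N] : Prop :=
  GhostVanish (k := k) e (constantCoeff (σ := Fin c) (R := K)) (ghostBase a) (ghostStep K c)
    (ghostDir K c) c j N

theorem pathSeq_ghost_zero (a : Fin c → K) (i : ℕ) :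
    pathSeq (ghostBase a) (ghostStep K c) (ghostDir K c) i 0 = 1 := by
  induction i with
  | zero => rfl
  | succ i ih => simp [pathSeq, ih, ghostDir]

theorem constantCoeff_pathSeq_ghost (a : Fin c → K) (i : ℕ) (l : Fin c) :
    constantCoeff (pathSeq (ghostBase a) (ghostStep K c) (ghostDir K c) i l.succ) = a l := by
  induction i with
  | zero => simp [pathSeq, ghostBase]
  | succ i ih =>
    have : constantCoeff (ghostStep K c i) = 0 := by
      rw [ghostStep]
      split_ifs <;> simp
    simp [pathSeq, ih, this]

variable {X : Type} [AddCommGroup X] [Module A X] [Module k X] [IsScalarTower k A X]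

theorem exists_ghostVanishAt_one [FiniteDimensional k X] (e : Fin (c + 1) → A) :
    ∃ h : MvPolynomial (Fin c) k, h ≠ 0 ∧ ∀ (K : Type) [Field K] [Algebra k K] (a : Fin c → K),
      aeval a h ≠ 0 → GhostVanishAt (k := k) e a 1 X := by
  obtain ⟨h, hh, hQ⟩ := exists_koszul_generic_inverse (k := k) (X := X) e
  refine ⟨h, hh, fun K _ _ a ha i hi => ?_⟩
  set s := pathSeq (ghostBase a) (ghostStep K c) (ghostDir K c) with hs
  obtain ⟨Q, hQ⟩ := hQ (MvPolynomial (Fin c) K) (s (i + 1)) (pathSeq_ghost_zero a _)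
  refine ⟨aeval (fun l => s (i + 1) l.succ) h, ?_, fun z hz => ?_⟩
  · convert ha
    have hC (r : k) : constantCoeff (algebraMap k (MvPolynomial (Fin c) K) r) =
        algebraMap k K r := by
      rw [IsScalarTower.algebraMap_apply k K (MvPolynomial (Fin c) K), algebraMap_eq,
        constantCoeff_C]
    let ψ : MvPolynomial (Fin c) K →ₐ[k] K := { constantCoeff with commutes' := hC }
    have : ψ.comp (aeval (fun l => s (i + 1) l.succ)) = aeval a := by
      ext l
      simpa using! constantCoeff_pathSeq_ghost a (i + 1) l
    exact DFunLike.congr_fun this h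
  · refine ⟨Q (koszul e X (ghostDir K c i) z), ?_⟩
    have hy : ghostStep K c i ≠ 0 := by
      rw [ghostStep, dif_pos (by lia)]
      exact X_ne_zero _
    have h1 : koszul e X (s (i + 1)) z = ghostStep K c i • koszul e X (ghostDir K c i) z := by
      rw [hs, pathSeq, koszul_add, koszul_smul, hz, zero_add]
    have h2 := hQ z
    rw [h1, map_smul, map_smul, smul_comm] at h2
    exact (smul_right_injective _ hy h2).symm

end GhostData

section SeparablePoint

theorem infinite_separableClosure (k : Type) [Field k] : Infinite (SeparableClosure k) := by
  by_contra h
  have : Finite (SeparableClosure k) := not_infinite_iff_finite.1 h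
  have : IsAlgClosed (SeparableClosure k) := inferInstance
  exact h inferInstance

theorem exists_separable_point {k : Type} [Field k] {c : ℕ} {h : MvPolynomial (Fin c) k}
    (hh : h ≠ 0) : ∃ (K : Type) (_ : Field K) (_ : Algebra k K) (a : Fin c → K),
      FiniteDimensional k K ∧ Algebra.IsSeparable k K ∧ MvPolynomial.aeval a h ≠ 0 := by
  let L := SeparableClosure k
  have : Infinite L := infinite_separableClosure k
  obtain ⟨a, ha⟩ : ∃ a : Fin c → L, MvPolynomial.aeval a h ≠ 0 := by
    by_contra! H
    refine hh (MvPolynomial.map_injective _ (algebraMap k L).injective ?_)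
    refine MvPolynomial.funext fun a => ?_
    rw [MvPolynomial.eval_map, ← MvPolynomial.aeval_def, H, map_zero, map_zero]
  let K := IntermediateField.adjoin k (Set.range a)
  have : FiniteDimensional k K := IntermediateField.finiteDimensional_adjoin
    fun x _ => Algebra.IsIntegral.isIntegral x
  let a' (l : Fin c) : K := ⟨a l, IntermediateField.subset_adjoin k _ ⟨l, rfl⟩⟩
  refine ⟨K, inferInstance, inferInstance, a', inferInstance, inferInstance, fun h0 => ha ?_⟩
  have : MvPolynomial.aeval a h = K.val (MvPolynomial.aeval a' h) := by
    rw [← AlgHom.comp_apply]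
    congr 1
    ext l
    simp [a']
  rw [this, h0, map_zero]

end SeparablePoint

section Induction

variable {k : Type} [Field k] {A : Type} [Ring A] [Algebra k A]
  {X : Type} [AddCommGroup X] [Module A X] [Module k X] [IsScalarTower k A X]

theorem exists_toDual_comp_ne_zero {X : Type} [AddCommGroup X] [Module A X]
    (d : (A →ₗ[k] k) →ₗ[A] X) (hd : Function.Injective d) {W : Type} [AddCommGroup W]
    [Module A W] [Module k W] [IsScalarTower k A W] {w : W} (hw : w ≠ 0) :
    ∃ g : W →ₗ[A] X, g w ≠ 0 := by
  obtain ⟨g, hg⟩ := exists_toDual_ne_zero k (A := A) hw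
  exact ⟨d ∘ₗ g, fun h => hg (hd (by rw [map_zero]; exact h))⟩

theorem exists_injective_left_approximation [FiniteDimensional k X] (d : (A →ₗ[k] k) →ₗ[A] X)
    (hd : Function.Injective d) (N : Type) [AddCommGroup N] [Module A N] [Module k N]
    [IsScalarTower k A N] [FiniteDimensional k N] : ∃ (m : ℕ) (u : N →ₗ[A] (Fin m → X)),
      Function.Injective u ∧ Function.Surjective (precompEnd X u) := by
  obtain ⟨m, u, hu⟩ := exists_left_approximation k (A := A) (W := N) (Z := X)
  refine ⟨m, u, (injective_iff_map_eq_zero u).2 fun x hx => ?_, hu⟩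
  by_contra h0
  obtain ⟨g, hg⟩ := exists_toDual_comp_ne_zero d hd h0
  obtain ⟨g', rfl⟩ := hu g
  exact hg (by rw [LinearMap.comp_apply, hx, map_zero])

/-- Projective dimension bounds the vanishing order, provided `X` contains `A*`. -/
theorem GhostVanish.of_homPdLT {ι : Type} [Fintype ι] {e : ι → A} (he : Anticommuting e)
    {S : Type} [CommRing S] [Algebra k S] {K : Type} [Field K] {κ : S →+* K} {s₀ : ι → S}
    {y : ℕ → S} {v : ℕ → ι → S} {c : ℕ} [FiniteDimensional k X]
    (d : (A →ₗ[k] k) →ₗ[A] X) (hd : Function.Injective d)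
    (hX : GhostVanish (k := k) e κ s₀ y v c 1 X) (j : ℕ) (N : Type) [AddCommGroup N] [Module A N]
    [Module k N] [IsScalarTower k A N] [FiniteDimensional k N]
    (hN : HomPdLT (A := A) X N (j + 1)) : GhostVanish (k := k) e κ s₀ y v c (j + 1) N := by
  obtain ⟨m, u, hinj, hu⟩ := exists_injective_left_approximation d hd N
  induction j generalizing N m with
  | zero =>
    obtain ⟨r, hr⟩ := HomProj.exists_retraction (pdLT_one_iff.1 hN) u hu hinj
      fun q hq => exists_toDual_comp_ne_zero d hd hq
    exact hX.pi.retract u r hr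
  | succ j ih =>
    obtain ⟨m', u', hinj', hu'⟩ :=
      exists_injective_left_approximation d hd ((Fin m → X) ⧸ LinearMap.range u)
    exact hX.pi.step he (ih _ (HomPdLT.coker u hu (homProj_self X).pi hN) m' u' hinj' hu') u hinj _
      (LinearMap.range u).mkQ_surjective (LinearMap.exact_map_mkQ_range u)

theorem homPdLT_of_gldimLE {X : Type} [AddCommGroup X] [Module A X] [FiniteDimensional k A] {c : ℕ}
    (h : gldimLE (Module.End A X) (c + 2))
    (hA : HomProj (A := A) X A) (W : Type) [AddCommGroup W] [Module A W] [Module k W]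
    [IsScalarTower k A W] [FiniteDimensional k W] : HomPdLT (A := A) X W (c + 1) := by
  obtain ⟨p, q, g, ⟨f⟩⟩ := exists_presentation k (A := A) (W := W)
  have h1 := homPdLT_coker_of_gldimLE h g hA.pi hA.pi
  let f' : (((Fin q → A) ⧸ LinearMap.range g) →ₗ[A] X) ≃ₗ[Module.End A X] (W →ₗ[A] X) :=
    LinearEquiv.ofLinearMap (precompEnd X f.symm.toLinearMap) (precompEnd X f.toLinearMap)
      (by ext; simp) (by ext; simp)
  exact PdLT.congr f' h1

end Induction

section Obstruction

open TensorProduct MvPolynomial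

variable {k : Type} [Field k] {A : Type} [Ring A] [Algebra k A] {c : ℕ}
  {K : Type} [Field K] [Algebra k K]

section Evaluation

variable {G : Type} [Ring G] [Algebra K G] [Module k G] [IsScalarTower k K G]

/-- Evaluation of the polynomial coefficients at the origin. -/
noncomputable def evalZero (k K G : Type) (c : ℕ) [Field k] [Field K] [Algebra k K] [Ring G]
    [Algebra K G] [Module k G] [IsScalarTower k K G] :
    MvPolynomial (Fin c) K ⊗[k] G →ₗ[k] G :=
  TensorProduct.lift (LinearMap.mk₂ k (fun x g => constantCoeff x • g)
    (fun x y g => by rw [map_add, add_smul])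
    (fun r x g => by rw [constantCoeff_eq, coeff_smul, smul_assoc])
    (fun x g h => smul_add _ _ _) (fun r x g => smul_comm _ _ _))

theorem evalZero_tmul (x : MvPolynomial (Fin c) K) (g : G) :
    evalZero k K G c (x ⊗ₜ g) = constantCoeff x • g := rfl

theorem evalZero_smul (x : MvPolynomial (Fin c) K) (z : MvPolynomial (Fin c) K ⊗[k] G) :
    evalZero k K G c (x • z) = constantCoeff x • evalZero k K G c z := by
  induction z with
  | zero => simp
  | add z w hz hw => rw [smul_add, map_add, map_add, hz, hw, smul_add]
  | tmul y g => rw [smul_tmul', evalZero_tmul, evalZero_tmul, smul_eq_mul, map_mul, mul_smul]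

variable [Module A G] [IsScalarTower k A G]

theorem evalZero_koszul (e : Fin (c + 1) → A) (s : Fin (c + 1) → MvPolynomial (Fin c) K)
    (b : Fin (c + 1) → G) (hb : ∀ l g, e l • g = b l * g)
    (z : MvPolynomial (Fin c) K ⊗[k] G) :
    evalZero k K G c (koszul e G s z) =
      (∑ l, constantCoeff (s l) • b l) * evalZero k K G c z := by
  induction z with
  | zero => simp
  | add z w hz hw => rw [map_add, map_add, map_add, hz, hw, mul_add]
  | tmul y g =>
    simp [koszul_tmul, evalZero_tmul, hb, mul_smul, Finset.sum_mul, Finset.smul_sum,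
      smul_comm (constantCoeff y)]

end Evaluation

/-- The embedding of `K ⊗ K` in `K[X] ⊗ G`. -/
noncomputable def separabilityEmbedding (k K G : Type) (c : ℕ) [Field k] [Field K] [Algebra k K]
    [Ring G] [Algebra K G] [Module k G] [IsScalarTower k K G] :
    K ⊗[k] K →ₗ[k] MvPolynomial (Fin c) K ⊗[k] G :=
  TensorProduct.map ((Algebra.linearMap K (MvPolynomial (Fin c) K)).restrictScalars k)
    ((Algebra.linearMap K G).restrictScalars k)

section Separable

variable {G : Type} [Ring G] [Algebra K G] [Module k G] [IsScalarTower k K G]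

theorem evalZero_separabilityEmbedding (w : K ⊗[k] K) :
    evalZero k K G c (separabilityEmbedding k K G c w) =
      algebraMap K G (Algebra.TensorProduct.lmul' k w) := by
  induction w with
  | zero => simp
  | add z w hz hw => simp only [map_add, hz, hw]
  | tmul x y =>
    simp [separabilityEmbedding, evalZero_tmul, Algebra.smul_def, MvPolynomial.algebraMap_eq]

variable [Module A G] [IsScalarTower k A G]

theorem koszul_separabilityEmbedding (e : Fin (c + 1) → A) (b : Fin (c + 1) → G)
    (hb : ∀ l g, e l • g = b l * g) (a : Fin c → K) (hb0 : b 0 = -∑ l, a l • b l.succ)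
    (w : K ⊗[k] K) :
    koszul e G (ghostBase a) (separabilityEmbedding k K G c w) =
      ∑ l : Fin c, (Algebra.lsmul k k G (e l.succ)).baseChange (MvPolynomial (Fin c) K)
        (separabilityEmbedding k K G c ((a l ⊗ₜ 1 - 1 ⊗ₜ a l) * w)) := by
  induction w with
  | zero => simp
  | add z w hz hw => simp only [map_add, mul_add, Finset.sum_add_distrib, hz, hw]
  | tmul x y =>
    have hcomm (l : Fin c) : b l.succ * (algebraMap K G (a l) * algebraMap K G y) =
        a l • (b l.succ * algebraMap K G y) := by
      rw [← Algebra.smul_def, mul_smul_comm]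
    simp [separabilityEmbedding, koszul_tmul, Fin.sum_univ_succ, ghostBase, sub_mul, hb, hb0,
      Finset.sum_mul, tmul_neg, tmul_sum, MvPolynomial.algebraMap_eq, hcomm, neg_add_eq_sub]

theorem koszul_separability_elem [FiniteDimensional k K] [Algebra.IsSeparable k K]
    (e : Fin (c + 1) → A) (b : Fin (c + 1) → G)
    (hb : ∀ l g, e l • g = b l * g) (a : Fin c → K) (hb0 : b 0 = -∑ l, a l • b l.succ) :
    ∃ z : MvPolynomial (Fin c) K ⊗[k] G, koszul e G (ghostBase a) z = 0 ∧
      evalZero k K G c z = 1 := by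
  have := Algebra.FormallyUnramified.of_isSeparable k K
  refine ⟨separabilityEmbedding k K G c (Algebra.FormallyUnramified.elem k K), ?_, ?_⟩
  · rw [koszul_separabilityEmbedding e b hb a hb0]
    refine Finset.sum_eq_zero fun l _ => ?_
    rw [sub_mul, Algebra.FormallyUnramified.one_tmul_mul_elem, sub_self, map_zero, map_zero]
  · rw [evalZero_separabilityEmbedding, Algebra.FormallyUnramified.lmul_elem, map_one]

end Separable

section Exterior

theorem evalZero_koszulIter_ghostDir [Module A (ExteriorAlgebra K (Fin c → K))]
    [IsScalarTower k A (ExteriorAlgebra K (Fin c → K))] (e : Fin (c + 1) → A)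
    (b : Fin (c + 1) → ExteriorAlgebra K (Fin c → K)) (hb : ∀ l g, e l • g = b l * g)
    (hbs : ∀ l : Fin c, b l.succ = extBasis K c {l}) (i j : ℕ) (hij : i + j = c) :
    ∃ r : K, r ≠ 0 ∧ ∀ z : MvPolynomial (Fin c) K ⊗[k] ExteriorAlgebra K (Fin c → K),
      evalZero k K _ c (koszulIter e _ (ghostDir K c) i j z) =
        r • extBasis K c (Finset.univ.filter fun l => i ≤ (l : ℕ)) * evalZero k K _ c z := by
  induction j generalizing i with
  | zero =>
    refine ⟨1, one_ne_zero, fun z => ?_⟩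
    have : (Finset.univ.filter fun l : Fin c => i ≤ (l : ℕ)) = ∅ := by
      ext l
      simp
      lia
    rw [this, extBasis_empty, one_smul, one_mul]
    rfl
  | succ j ih =>
    obtain ⟨r, hr, h⟩ := ih (i + 1) (by lia)
    let l₀ : Fin c := ⟨i, by lia⟩
    have hdisj : Disjoint (Finset.univ.filter fun l : Fin c => i + 1 ≤ (l : ℕ)) {l₀} := by
      simp [l₀]
    obtain ⟨r', hr', h'⟩ := extBasis_mul_of_disjoint (k := K) hdisj
    refine ⟨r * r', mul_ne_zero hr hr', fun z => ?_⟩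
    have hsum : ∑ l, constantCoeff (ghostDir K c i l) • b l = extBasis K c {l₀} := by
      rw [Finset.sum_eq_single l₀.succ, hbs]
      · simp [ghostDir, l₀]
      · intro l _ hl
        have : (l : ℕ) ≠ i + 1 := fun h => hl (Fin.ext h)
        simp [ghostDir, this]
      · simp
    have hunion : (Finset.univ.filter fun l : Fin c => i + 1 ≤ (l : ℕ)) ∪ {l₀} =
        Finset.univ.filter fun l : Fin c => i ≤ (l : ℕ) := by
      ext l
      simp [l₀, Fin.ext_iff]
      lia
    rw [koszulIter, LinearMap.comp_apply, h, evalZero_koszul e _ b hb, hsum, ← mul_assoc,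
      smul_mul_assoc, h', hunion, smul_smul]

theorem not_ghostVanishAt [FiniteDimensional k K] [Algebra.IsSeparable k K]
    [Module A (ExteriorAlgebra K (Fin c → K))]
    [IsScalarTower k A (ExteriorAlgebra K (Fin c → K))] (e : Fin (c + 1) → A)
    (b : Fin (c + 1) → ExteriorAlgebra K (Fin c → K)) (hb : ∀ l g, e l • g = b l * g)
    (hbs : ∀ l : Fin c, b l.succ = extBasis K c {l}) (a : Fin c → K)
    (hb0 : b 0 = -∑ l, a l • b l.succ) :
    ¬GhostVanishAt (k := k) e a c (ExteriorAlgebra K (Fin c → K)) := by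
  intro h
  obtain ⟨H, hH, h⟩ := h 0 (by lia)
  obtain ⟨z, hz, hz1⟩ := koszul_separability_elem (k := k) e b hb a hb0
  obtain ⟨t, ht⟩ := h z hz
  obtain ⟨r, hr, hW⟩ := evalZero_koszulIter_ghostDir (k := k) e b hb hbs 0 c (by lia)
  have h1 := congrArg (evalZero k K _ c) ht
  have hsum : ∑ l, constantCoeff (pathSeq (ghostBase a) (ghostStep K c) (ghostDir K c) (0 + c) l) •
      b l = 0 := by
    rw [Fin.sum_univ_succ, pathSeq_ghost_zero]
    simp only [constantCoeff_pathSeq_ghost, hb0, map_one, one_smul, neg_add_cancel]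
  rw [evalZero_smul, hW, hz1, evalZero_koszul e _ b hb, hsum, zero_mul, mul_one, smul_smul] at h1
  exact (smul_ne_zero (mul_ne_zero hH hr) (Module.Basis.ne_zero _ _)) h1

end Exterior

section LowerBound

variable (k) in
/-- The generators of the exterior algebra of `k^n`. -/
noncomputable def extGen (n : ℕ) (l : Fin n) : ExteriorAlgebra k (Fin n → k) :=
  ExteriorAlgebra.ι k (Pi.single l 1)

theorem anticommuting_extGen (n : ℕ) : Anticommuting (extGen k n) :=
  ⟨fun _ => ExteriorAlgebra.ι_sq_zero _, fun _ _ => ExteriorAlgebra.ι_add_mul_swap _ _⟩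

/-- The linear projection from `(1, a)`. -/
noncomputable def projectFrom (k : Type) [Field k] [Algebra k K] (a : Fin c → K) :
    (Fin (c + 1) → k) →ₗ[k] (Fin c → K) :=
  LinearMap.pi fun l => Algebra.linearMap k K ∘ₗ LinearMap.proj l.succ -
    (LinearMap.proj 0).smulRight (a l)

theorem projectFrom_single_zero (a : Fin c → K) : projectFrom k a (Pi.single 0 1) = -a := by
  ext l
  simp [projectFrom]

theorem projectFrom_single_succ (a : Fin c → K) (l : Fin c) :
    projectFrom k a (Pi.single l.succ 1) = Pi.single l 1 := by
  ext m
  simp [projectFrom, Pi.single_apply]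

/-- The algebra map between exterior algebras induced by the projection from `(1, a)`. -/
noncomputable def extProjectFrom (k : Type) [Field k] [Algebra k K] (a : Fin c → K) :
    ExteriorAlgebra k (Fin (c + 1) → k) →ₐ[k] ExteriorAlgebra K (Fin c → K) :=
  ExteriorAlgebra.lift k ⟨(ExteriorAlgebra.ι K).restrictScalars k ∘ₗ projectFrom k a,
    fun _ => ExteriorAlgebra.ι_sq_zero _⟩

theorem extProjectFrom_extGen (a : Fin c → K) (l : Fin (c + 1)) :
    extProjectFrom k a (extGen k (c + 1) l) =
      ExteriorAlgebra.ι K (projectFrom k a (Pi.single l 1)) := by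
  exact ExteriorAlgebra.lift_ι_apply k _ _ _

variable {X : Type} [AddCommGroup X] [Module (ExteriorAlgebra k (Fin (c + 1) → k)) X] [Module k X]
  [IsScalarTower k (ExteriorAlgebra k (Fin (c + 1) → k)) X] [FiniteDimensional k X]

theorem not_gldimLE_end_of_pos (hc : 0 < c)
    (hA : HomProj (A := ExteriorAlgebra k (Fin (c + 1) → k)) X
      (ExteriorAlgebra k (Fin (c + 1) → k)))
    (d : (ExteriorAlgebra k (Fin (c + 1) → k) →ₗ[k] k)
      →ₗ[ExteriorAlgebra k (Fin (c + 1) → k)] X) (hd : Function.Injective d) :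
    ¬gldimLE (Module.End (ExteriorAlgebra k (Fin (c + 1) → k)) X) (c + 1) := by
  intro hgl
  obtain ⟨h, hh, hghost⟩ := exists_ghostVanishAt_one (k := k) (X := X) (extGen k (c + 1))
  obtain ⟨K, _, _, a, _, _, ha⟩ := exists_separable_point hh
  let ρ := extProjectFrom k a
  let : Module (ExteriorAlgebra k (Fin (c + 1) → k)) (ExteriorAlgebra K (Fin c → K)) :=
    Module.compHom _ ρ.toRingHom
  have hsmul (x : ExteriorAlgebra k (Fin (c + 1) → k)) (g : ExteriorAlgebra K (Fin c → K)) :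
    x • g = ρ x * g := rfl
  have : IsScalarTower k (ExteriorAlgebra k (Fin (c + 1) → k)) (ExteriorAlgebra K (Fin c → K)) :=
    ⟨fun r x g => by rw [hsmul, hsmul, map_smul, smul_mul_assoc]⟩
  have : FiniteDimensional k (ExteriorAlgebra K (Fin c → K)) := Module.Finite.trans K _
  obtain ⟨c, rfl⟩ : ∃ c', c = c' + 1 := ⟨c - 1, by lia⟩
  have h1 := GhostVanish.of_homPdLT (anticommuting_extGen _) d hd (hghost K a ha) c _
    (homPdLT_of_gldimLE (k := k) hgl hA (ExteriorAlgebra K (Fin (c + 1) → K)))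
  refine not_ghostVanishAt (k := k) _ (fun l => ρ (extGen k _ l)) (fun l g => rfl)
    (fun l => ?_) a ?_ h1
  · rw [extProjectFrom_extGen, projectFrom_single_succ, extBasis_singleton]
  · simp only [ρ, extProjectFrom_extGen, projectFrom_single_succ, projectFrom_single_zero,
      map_neg, ← map_smul, ← map_sum]
    congr
    ext l
    simp [Finset.sum_apply, Pi.single_apply]

end LowerBound

end Obstruction

section DimensionOne

variable {A : Type} [Ring A] {X Y : Type} [AddCommGroup X] [Module A X] [AddCommGroup Y]
  [Module A Y]

/-- A ring of endomorphisms of a module with a retract carrying a nonzero central endomorphism of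
square zero is not hereditary. -/
theorem not_gldimLE_one_end (i : Y →ₗ[A] X) (r : X →ₗ[A] Y) (hri : r ∘ₗ i = LinearMap.id)
    (g : Y →ₗ[A] Y) (hg : g ∘ₗ g = 0) (hg0 : g ≠ 0) (hcomm : ∀ f : Y →ₗ[A] Y, f ∘ₗ g = g ∘ₗ f) :
    ¬gldimLE (Module.End A X) 1 := by
  intro h
  set p := precompEnd X g
  have hR : Module.Projective (Module.End A X) (LinearMap.range p) := by
    have hQ := (pdLE_iff_pdLT _ _).1 (h ((Y →ₗ[A] X) ⧸ LinearMap.range p) _ _)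
    have hY : PdLT (Module.End A X) (Y →ₗ[A] X) 1 :=
      pdLT_one_iff.2 ((homProj_self X).retract i r hri)
    refine pdLT_one_iff.1 ((PdLT.ker (LinearMap.range p).mkQ_surjective hY hQ).congr ?_)
    exact LinearEquiv.ofEq _ _ (Submodule.ker_mkQ _)
  obtain ⟨s, hs⟩ := Module.projective_lifting_property p.rangeRestrict LinearMap.id
    p.surjective_rangeRestrict
  let f : Y →ₗ[A] Y := r ∘ₗ s (p.rangeRestrict i)
  have hf (φ : Y →ₗ[A] X) : s (p.rangeRestrict φ) = φ ∘ₗ f := by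
    have h1 : φ = (φ ∘ₗ r : Module.End A X) • i := by
      ext y
      exact congrArg φ (LinearMap.congr_fun hri y).symm
    conv_lhs => rw [h1, map_smul, map_smul]
    rfl
  have hpf (φ : Y →ₗ[A] X) : (φ ∘ₗ f) ∘ₗ g = φ ∘ₗ g := by
    rw [← hf]
    exact congrArg Subtype.val (LinearMap.congr_fun hs (p.rangeRestrict φ))
  have hi : Function.Injective i :=
    Function.LeftInverse.injective fun y => LinearMap.congr_fun hri y
  have hfg : f ∘ₗ g = g := by
    ext y
    exact hi (LinearMap.congr_fun (hpf i) y)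
  have hgf : g ∘ₗ f = 0 := by
    have h0 : p.rangeRestrict (i ∘ₗ g) = 0 := by
      apply Subtype.ext
      change (i ∘ₗ g) ∘ₗ g = 0
      rw [LinearMap.comp_assoc, hg, LinearMap.comp_zero]
    have h1 := hf (i ∘ₗ g)
    rw [h0, map_zero] at h1
    ext y
    exact hi (by simpa using (LinearMap.congr_fun h1 y).symm)
  exact hg0 (by rw [← hfg, hcomm, hgf])

theorem extGen_commute {k : Type} [Field k] (x : ExteriorAlgebra k (Fin 1 → k)) :
    Commute (extGen k 1 0) x := by
  induction x using ExteriorAlgebra.induction with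
  | algebraMap r => exact (Algebra.commutes r _).symm
  | ι v =>
    have : ExteriorAlgebra.ι k v = v 0 • extGen k 1 0 := by
      rw [extGen, ← map_smul]
      congr
      ext l
      simp [Subsingleton.elim l 0]
    rw [this]
    exact (Commute.refl _).smul_right _
  | mul x y hx hy => exact hx.mul_right hy
  | add x y hx hy => exact hx.add_right hy

theorem not_gldimLE_end_exteriorAlgebra_one {k : Type} [Field k] {X : Type} [AddCommGroup X]
    [Module (ExteriorAlgebra k (Fin 1 → k)) X]
    (i : ExteriorAlgebra k (Fin 1 → k) →ₗ[ExteriorAlgebra k (Fin 1 → k)] X)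
    (r : X →ₗ[ExteriorAlgebra k (Fin 1 → k)] ExteriorAlgebra k (Fin 1 → k))
    (hri : r ∘ₗ i = LinearMap.id) :
    ¬gldimLE (Module.End (ExteriorAlgebra k (Fin 1 → k)) X) 1 := by
  refine not_gldimLE_one_end i r hri (LinearMap.toSpanSingleton _ _ (extGen k 1 0)) ?_ ?_ ?_
  · ext
    simp [(anticommuting_extGen 1).sq]
  · intro h
    have h1 : extGen k 1 0 = 0 := by simpa using LinearMap.congr_fun h 1
    rw [extGen, ← extBasis_singleton] at h1
    exact Module.Basis.ne_zero _ _ h1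
  · intro f
    ext
    have := f.map_smul (extGen k 1 0) 1
    simp only [smul_eq_mul, mul_one] at this
    simp [this, (extGen_commute (f 1)).eq]

end DimensionOne

theorem gldimLE.mono {B : Type} [Ring B] {d d' : ℕ} (h : gldimLE B d) (hd : d ≤ d') :
    gldimLE B d' := fun M _ _ =>
  (pdLE_iff_pdLT d' M).2 (((pdLE_iff_pdLT d M).1 (h M _ _)).mono (by lia))

theorem not_gldimLE_end_exteriorAlgebra (k : Type) [Field k] {n : ℕ} (hn : 0 < n) (M : Type)
    [AddCommGroup M] [Module (ExteriorAlgebra k (Fin n → k)) M]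
    [Module.Finite (ExteriorAlgebra k (Fin n → k)) M] :
    ¬gldimLE (Module.End (ExteriorAlgebra k (Fin n → k)) (ExteriorAlgebra k (Fin n → k) ×
      (ExteriorAlgebra k (Fin n → k) →ₗ[k] k) × M)) n := by
  obtain ⟨c, rfl⟩ : ∃ c, n = c + 1 := ⟨n - 1, by lia⟩
  rcases Nat.eq_zero_or_pos c with rfl | hc
  · exact not_gldimLE_end_exteriorAlgebra_one (LinearMap.inl _ _ _) (LinearMap.fst _ _ _)
      (LinearMap.fst_comp_inl _ _ _)
  · let : Module k M :=
      Module.compHom M (algebraMap k (ExteriorAlgebra k (Fin (c + 1) → k)))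
    have : IsScalarTower k (ExteriorAlgebra k (Fin (c + 1) → k)) M :=
      ⟨fun r x m => by
        rw [Algebra.smul_def, mul_smul]
        rfl⟩
    have : FiniteDimensional k M := Module.Finite.trans (ExteriorAlgebra k (Fin (c + 1) → k)) M
    exact not_gldimLE_end_of_pos hc
      ((homProj_self _).retract (LinearMap.inl _ _ _) (LinearMap.fst _ _ _)
        (LinearMap.fst_comp_inl _ _ _))
      (LinearMap.inr _ _ _ ∘ₗ LinearMap.inl _ _ _)
      (LinearMap.inr_injective.comp LinearMap.inl_injective)

/-- **Rouquier**: the representation dimension of the exterior algebra of an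
`n`-dimensional vector space (`n ≥ 1`) is `n + 1`. -/
theorem repdim_exteriorAlgebra (k : Type) [Field k] (n : ℕ) (hn : 0 < n) :
    repdim k (ExteriorAlgebra k (Fin n → k)) = (n : ℕ∞) + 1 := by
  refine le_antisymm ?_ (le_sInf ?_)
  · refine le_trans (b := gldim
      (Module.End (ExteriorAlgebra k (Fin n → k)) (extFiltration k n).Generator)) (sInf_le ?_)
      (sInf_le ?_)
    · exact ⟨(extFiltration k n).DualSum (n + 1), inferInstance, inferInstance,
        Module.Finite.of_restrictScalars_finite k _ _, rfl⟩
    · exact ⟨n + 1, (extFiltration k n).gldimLE_end_generator hn, by push_cast; rfl⟩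
  · rintro _ ⟨M, _, _, _, rfl⟩
    refine le_sInf ?_
    rintro _ ⟨d, hd, rfl⟩
    by_contra! hlt
    have hdn : d ≤ n := by
      have : d < n + 1 := by exact_mod_cast hlt
      lia
    exact not_gldimLE_end_exteriorAlgebra k hn M (hd.mono hdn)
end
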